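/- arXiv:2106.07422 — 2 statements merged into one kernel-verified Lean document; each statement's English description precedes it below -/
import Mathlib

section
/- There exists t > 0 such that for every h ∈ H there exists γ ∈ Γ_K with γh ∈ 𝔇_t; equivalently, Γ_K · 𝔇_t = H. -/
open MeasureTheory Matrix Set Pointwise

noncomputable section

/-- The real embedding of `ℤ[√2]`, `a + b√2 ↦ a + b√2`. -/
def emb (α : Zsqrtd 2) : ℝ := (α.re : ℝ) + (α.im : ℝ) * Real.sqrt 2

/-- The Galois-conjugate embedding `σ`, `a + b√2 ↦ a − b√2`. -/
def embc (α : Zsqrtd 2) : ℝ := (α.re : ℝ) - (α.im : ℝ) * Real.sqrt 2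

/-- The fundamental unit `λ = 1 + √2`. -/
def lam : ℝ := 1 + Real.sqrt 2

/-- `𝓛'`: the Minkowski embedding of `ℤ[√2]` in `ℝ²`. -/
def Lp : Set (ℝ × ℝ) := {p | ∃ α : Zsqrtd 2, p = (emb α, embc α)}

/-- `v(β₁,β₂) = (β₁, β₂, σ(β₁), σ(β₂))`. -/
def latvec (β₁ β₂ : Zsqrtd 2) : Fin 4 → ℝ := ![emb β₁, emb β₂, embc β₁, embc β₂]

/-- `𝓛`: the Minkowski embedding of `ℤ[√2]²` in `ℝ⁴`. -/
def Lquad : Set (Fin 4 → ℝ) := {v | ∃ β₁ β₂ : Zsqrtd 2, v = latvec β₁ β₂}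

/-- `𝓛h`, for a 4×4 real matrix `h` (row vectors, right multiplication). -/
def latimage (h : Matrix (Fin 4) (Fin 4) ℝ) : Set (Fin 4 → ℝ) :=
  (fun v => Matrix.vecMul v h) '' Lquad

def nmat (x : ℝ) : Matrix (Fin 2) (Fin 2) ℝ := !![1, x; 0, 1]
def amat (y : ℝ) : Matrix (Fin 2) (Fin 2) ℝ := !![y, 0; 0, y⁻¹]
def kmat (θ : ℝ) : Matrix (Fin 2) (Fin 2) ℝ :=
  !![Real.cos θ, -Real.sin θ; Real.sin θ, Real.cos θ]

/-- Block diagonal 4×4 matrix from two 2×2 blocks. -/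
def bd (A B : Matrix (Fin 2) (Fin 2) ℝ) : Matrix (Fin 4) (Fin 4) ℝ :=
  !![A 0 0, A 0 1, 0, 0;
     A 1 0, A 1 1, 0, 0;
     0, 0, B 0 0, B 0 1;
     0, 0, B 1 0, B 1 1]

/-- `h(x₁,x₂,y₁,y₂,θ₁,θ₂) = diag(n(x₁)a(y₁)k(θ₁), n(x₂)a(y₂)k(θ₂))`. -/
def hmat (x₁ x₂ y₁ y₂ θ₁ θ₂ : ℝ) : Matrix (Fin 4) (Fin 4) ℝ :=
  bd (nmat x₁ * amat y₁ * kmat θ₁) (nmat x₂ * amat y₂ * kmat θ₂)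

/-- `H = SL₂(ℝ)² ⊂ SL₄(ℝ)` (block diagonal). -/
def Hset : Set (Matrix (Fin 4) (Fin 4) ℝ) :=
  {h | ∃ A B : Matrix (Fin 2) (Fin 2) ℝ, A.det = 1 ∧ B.det = 1 ∧ h = bd A B}

/-- `Γ_K = {diag(A, σ(A)) : A ∈ SL₂(ℤ[√2])}`. -/
def GammaK : Set (Matrix (Fin 4) (Fin 4) ℝ) :=
  {g | ∃ A : Matrix (Fin 2) (Fin 2) (Zsqrtd 2), A.det = 1 ∧ g = bd (A.map emb) (A.map embc)}

/-- `𝒲`: the open regular octagon of side length √2. -/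
def Woct : Set (ℝ × ℝ) :=
  {p | |p.1| < lam / Real.sqrt 2 ∧ |p.2| < lam / Real.sqrt 2 ∧ |p.1| + |p.2| < lam}

/-- `𝒲' = 𝒲 ∖ (√2−1)𝒲`. -/
def Wp : Set (ℝ × ℝ) := Woct \ ((Real.sqrt 2 - 1) • Woct)

/-- `θ̂ = 48√2/π⁴`, the density of visible points. -/
def thetaHat : ℝ := 48 * Real.sqrt 2 / Real.pi ^ 4

/-- `T(s)`: open triangle with vertices `(0,0)`, `(s/θ̂)^{1/2}(1,±1)`. -/
def Tset (s : ℝ) : Set (ℝ × ℝ) :=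
  {p | 0 < p.1 ∧ p.1 < Real.sqrt (s / thetaHat) ∧ |p.2| < p.1}

/-- `𝔉`: a fundamental domain of `𝓛'`. -/
def Fdom : Set (ℝ × ℝ) :=
  {p | ∃ r₁ ∈ Set.Ico (0:ℝ) 1, ∃ r₂ ∈ Set.Ico (0:ℝ) 1,
    p = (1 + r₁ + r₂ * Real.sqrt 2, 2 + r₁ - r₂ * Real.sqrt 2)}

/-- The Siegel domain `𝔇_t`. -/
def Dset (t : ℝ) : Set (Matrix (Fin 4) (Fin 4) ℝ) :=
  {h | ∃ x₁ x₂ y₁ y₂ θ₁ θ₂ : ℝ, (x₁, x₂) ∈ Fdom ∧ 0 < y₁ ∧ 0 < y₂ ∧ t ≤ y₁ * y₂ ∧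
    lam ^ (-2 : ℤ) ≤ y₁ / y₂ ∧ y₁ / y₂ ≤ lam ^ 2 ∧
    θ₁ ∈ Set.Ico 0 Real.pi ∧ θ₂ ∈ Set.Ico 0 Real.pi ∧ h = hmat x₁ x₂ y₁ y₂ θ₁ θ₂}

/-- Row vector times 2×2 matrix, on `ℝ × ℝ`. -/
def mul2 (p : ℝ × ℝ) (M : Matrix (Fin 2) (Fin 2) ℝ) : ℝ × ℝ :=
  (p.1 * M 0 0 + p.2 * M 1 0, p.1 * M 0 1 + p.2 * M 1 1)

/-- `r(s)`: the unique integer with `λ^{2r} ≤ s^{1/4} < λ^{2(r+1)}`. -/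
def rr (s : ℝ) : ℤ := ⌊Real.logb (lam ^ 2) (s ^ ((1:ℝ)/4))⌋

/-- `𝒯(s)` with explicit integer `r`: `λ^{−2r}T(s) × λ^{2r}𝒲`. -/
def calT (s : ℝ) (r : ℤ) : Set (Fin 4 → ℝ) :=
  {v | (lam ^ (2*r) * v 0, lam ^ (2*r) * v 1) ∈ Tset s ∧
       (lam ^ (-(2*r)) * v 2, lam ^ (-(2*r)) * v 3) ∈ Woct}

/-- `𝒯(s) = λ^{−2r(s)}T(s) × λ^{2r(s)}𝒲`. -/
def calTs (s : ℝ) : Set (Fin 4 → ℝ) := calT s (rr s)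

/-- Euclidean norm on `ℝ⁴`. -/
def enorm4 (v : Fin 4 → ℝ) : ℝ := Real.sqrt (∑ i, (v i) ^ 2)

/-- `𝓛h̃ = (ℤ(y₁,0,y₂,0) + ℤ√2(y₁,0,−y₂,0) + ℝ(0,1,0,0) + ℝ(0,0,0,1))·diag(k(θ₁),k(θ₂))`. -/
def Ltilde (y₁ y₂ θ₁ θ₂ : ℝ) : Set (Fin 4 → ℝ) :=
  {v | ∃ (m n : ℤ) (c₁ c₂ : ℝ),
    v = Matrix.vecMul ![((m:ℝ) + (n:ℝ) * Real.sqrt 2) * y₁, c₁,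
          ((m:ℝ) - (n:ℝ) * Real.sqrt 2) * y₂, c₂] (bd (kmat θ₁) (kmat θ₂))}

open Classical in
/-- Real-valued indicator of a proposition. -/
def ind (P : Prop) : ℝ := if P then 1 else 0

/-- `c_H = 3/π⁴`. -/
def cH : ℝ := 3 / Real.pi ^ 4

/-- `Y_t = {(y₁,y₂) : y₁,y₂ > 0, y₁y₂ ≥ t, y₁/y₂ ∈ (λ⁻²,λ²)}`. -/
def Yt (t : ℝ) : Set (ℝ × ℝ) :=
  {y | 0 < y.1 ∧ 0 < y.2 ∧ t ≤ y.1 * y.2 ∧ lam ^ (-2:ℤ) < y.1 / y.2 ∧ y.1 / y.2 < lam ^ 2}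

/-- The main term `G_M(s)` (depending on the Siegel-domain parameter `t`). -/
def GM (t s : ℝ) : ℝ :=
  cH * ∫ θ₂ in Set.Ico (0:ℝ) Real.pi, ∫ θ₁ in Set.Ico (0:ℝ) Real.pi, ∫ y in Yt t, ∫ x in Fdom,
    (y.1 ^ 3 * y.2 ^ 3)⁻¹ * ind (Ltilde y.1 y.2 θ₁ θ₂ ∩ calTs s = ∅)

/-- The error term `G_E(s)`. -/
def GE (t s : ℝ) : ℝ :=
  cH * ∫ θ₂ in Set.Ico (0:ℝ) Real.pi, ∫ θ₁ in Set.Ico (0:ℝ) Real.pi, ∫ y in Yt t, ∫ x in Fdom,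
    (y.1 ^ 3 * y.2 ^ 3)⁻¹ *
      ind (latimage (hmat x.1 x.2 y.1 y.2 θ₁ θ₂) ∩ calTs s = ∅ ∧
           (Ltilde y.1 y.2 θ₁ θ₂ ∩ calTs s).Nonempty)

/-- `J = [0,π/4] ∪ [3π/4,π)`. -/
def Jset : Set ℝ := Set.Icc 0 (Real.pi/4) ∪ Set.Ico (3*Real.pi/4) Real.pi

/-- `Y = {(y₁,y₂) : y₁ > 0, 1 < y₂ < λ²}`. -/
def Yset : Set (ℝ × ℝ) := {y | 0 < y.1 ∧ 1 < y.2 ∧ y.2 < lam ^ 2}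

/-- `T₁`: open triangle with vertices `(0,0)`, `(1,±1)`. -/
def T1 : Set (ℝ × ℝ) := {p | 0 < p.1 ∧ p.1 < 1 ∧ |p.2| < p.1}

/-- `ℓ₁(θ₁)`: first-coordinate projection of `θ̂^{−1/2}T₁k(−θ₁)`. -/
def ell1 (θ₁ : ℝ) : Set ℝ :=
  {x | ∃ p ∈ T1, x = (mul2 ((Real.sqrt thetaHat)⁻¹ • p) (kmat (-θ₁))).1}

/-- `ℓ₂(θ₂)`: first-coordinate projection of `𝒲k(−θ₂)`. -/
def ell2 (θ₂ : ℝ) : Set ℝ := {x | ∃ p ∈ Woct, x = (mul2 p (kmat (-θ₂))).1}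

/-- `C_𝒫 = 2304(2−√2)/π⁸`. -/
def CP : ℝ := 2304 * (2 - Real.sqrt 2) / Real.pi ^ 8

/-- `ζ_K(2) = π⁴/(48√2)`. -/
def zetaK2 : ℝ := Real.pi ^ 4 / (48 * Real.sqrt 2)

/-- `𝒯'(s) = T(s) × 𝒲`. -/
def Tprime (s : ℝ) : Set (Fin 4 → ℝ) :=
  {v | (v 0, v 1) ∈ Tset s ∧ (v 2, v 3) ∈ Woct}

/-- `L₁(θ₁)` from Lemma 3.4: projection of `λ^{−2r}T(s)k(−θ₁)` onto the x-axis. -/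
def L1set (s : ℝ) (r : ℤ) (θ₁ : ℝ) : Set ℝ :=
  {x | ∃ p ∈ Tset s, x = (mul2 ((lam ^ (-(2*r)) : ℝ) • p) (kmat (-θ₁))).1}

/-- `L₂(θ₂)`: projection of `λ^{2r}𝒲k(−θ₂)` onto the x-axis. -/
def L2set (r : ℤ) (θ₂ : ℝ) : Set ℝ :=
  {x | ∃ p ∈ Woct, x = (mul2 ((lam ^ (2*r) : ℝ) • p) (kmat (-θ₂))).1}

/-- `n(x)a(y)k(θ)` where `y,θ` are determined by `y⁻¹(sin θ, cos θ) = z`. -/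
def hz (z : ℝ × ℝ) (x : ℝ) : Matrix (Fin 2) (Fin 2) ℝ :=
  nmat x * amat (Real.sqrt (z.1 ^ 2 + z.2 ^ 2))⁻¹ *
    !![(Real.sqrt (z.1 ^ 2 + z.2 ^ 2))⁻¹ * z.2, -((Real.sqrt (z.1 ^ 2 + z.2 ^ 2))⁻¹ * z.1);
       (Real.sqrt (z.1 ^ 2 + z.2 ^ 2))⁻¹ * z.1, (Real.sqrt (z.1 ^ 2 + z.2 ^ 2))⁻¹ * z.2]

/-- The function `F₂` of Lemma 4.7. -/
def F2 (z₁ : ℝ) : ℝ :=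
  (24 / Real.pi ^ 4) * ∫ z₂ in Set.Ioo (-z₁) z₁, ∫ w in Wp, ∫ x in Fdom,
    ind (latimage (bd (hz (z₁, z₂) x.1) (hz w x.2)) ∩ Tprime (z₁ ^ 2 * thetaHat) = ∅)

/-- The box `B(α₃,α₄)`. -/
def Bbox (α₃ α₄ : Zsqrtd 2) (C₁ s : ℝ) : Set (ℝ × ℝ) :=
  {x | |x.1 + emb α₄ / emb α₃| ≤ C₁ / Real.sqrt s ∧
       |x.2 + embc α₄ / embc α₃| ≤ C₁ / Real.sqrt s}

/-- The matrix `h` determined by `s, z₂, w, x₁, x₂` via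
`y₁⁻¹(sin θ₁, cos θ₁) = λ^{−2r}(θ̂^{−1/2}s^{1/2}, z₂)`, `y₂⁻¹(sin θ₂, cos θ₂) = λ^{2r}w`. -/
def hfull (s z₂ : ℝ) (w : ℝ × ℝ) (x₁ x₂ : ℝ) : Matrix (Fin 4) (Fin 4) ℝ :=
  bd (hz ((lam ^ (-(2 * rr s)) : ℝ) • (Real.sqrt (s / thetaHat), z₂)) x₁)
     (hz ((lam ^ (2 * rr s) : ℝ) • w) x₂)

/-- `F⁺_{(α₃,α₄)}(s)`. -/
def Fplus (α₃ α₄ : Zsqrtd 2) (C₁ s : ℝ) : ℝ :=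
  (Real.sqrt s)⁻¹ * ∫ z₂ in Set.Ioo (0:ℝ) (Real.sqrt (s / thetaHat)), ∫ w in Wp,
    ∫ x in Bbox α₃ α₄ C₁ s, ind (latimage (hfull s z₂ w x.1 x.2) ∩ calTs s = ∅)

/-- `F⁻_{(α₃,α₄)}(s)`. -/
def Fminus (α₃ α₄ : Zsqrtd 2) (C₁ s : ℝ) : ℝ :=
  (Real.sqrt s)⁻¹ * ∫ z₂ in Set.Ioo (-Real.sqrt (s / thetaHat)) (0:ℝ), ∫ w in Wp,
    ∫ x in Bbox α₃ α₄ C₁ s, ind (latimage (hfull s z₂ w x.1 x.2) ∩ calTs s = ∅)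

/-- `F_{(α₃,α₄)}(s)`. -/
def Ffull (α₃ α₄ : Zsqrtd 2) (C₁ s : ℝ) : ℝ :=
  (Real.sqrt s)⁻¹ *
    ∫ z₂ in Set.Ioo (-Real.sqrt (s / thetaHat)) (Real.sqrt (s / thetaHat)), ∫ w in Wp,
      ∫ x in Bbox α₃ α₄ C₁ s, ind (latimage (hfull s z₂ w x.1 x.2) ∩ calTs s = ∅)

/-- `v₁ = (α₃, α₄, σ(α₃), σ(α₄))`. -/
def vv1 (α₃ α₄ : Zsqrtd 2) : Fin 4 → ℝ := ![emb α₃, emb α₄, embc α₃, embc α₄]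

/-- `v₂ = (√2α₃, √2α₄, −√2σ(α₃), −√2σ(α₄))`. -/
def vv2 (α₃ α₄ : Zsqrtd 2) : Fin 4 → ℝ :=
  ![Real.sqrt 2 * emb α₃, Real.sqrt 2 * emb α₄,
    -(Real.sqrt 2 * embc α₃), -(Real.sqrt 2 * embc α₄)]

/-- `b₁ = (α₃, α₄, 0, 0)`. -/
def bb1 (α₃ α₄ : Zsqrtd 2) : Fin 4 → ℝ := ![emb α₃, emb α₄, 0, 0]

/-- `b₂ = (0, 0, σ(α₃), σ(α₄))`. -/
def bb2 (α₃ α₄ : Zsqrtd 2) : Fin 4 → ℝ := ![0, 0, embc α₃, embc α₄]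

/-- The subgrid `𝓛_v = v + ℤv₁ + ℤv₂`. -/
def Lv (α₃ α₄ : Zsqrtd 2) (v : Fin 4 → ℝ) : Set (Fin 4 → ℝ) :=
  {u | ∃ m n : ℤ, u = v + (m:ℝ) • vv1 α₃ α₄ + (n:ℝ) • vv2 α₃ α₄}

/-- The filled plane `Π_v = v + ℝb₁ + ℝb₂`. -/
def Piv (α₃ α₄ : Zsqrtd 2) (v : Fin 4 → ℝ) : Set (Fin 4 → ℝ) :=
  {u | ∃ c₁ c₂ : ℝ, u = v + c₁ • bb1 α₃ α₄ + c₂ • bb2 α₃ α₄}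

/-- `d(s) = θ̂^{−1/2}λ^{−2r}s^{1/2}`. -/
def ds (s : ℝ) : ℝ := lam ^ (-(2 * rr s)) * Real.sqrt (s / thetaHat)

/-- The explicit integral representation `Φ(s)` of the limiting gap distribution `F(s)`. -/
def Phi (s : ℝ) : ℝ :=
  (1 / ((2:ℝ) ^ ((11:ℝ)/2) * Real.sqrt thetaHat * zetaK2 * Real.sqrt s)) *
    ∫ z₂ in Set.Ioo (-Real.sqrt (s / thetaHat)) (Real.sqrt (s / thetaHat)), ∫ w in Wp,
      ∫ x in Fdom, ind (latimage (hfull s z₂ w x.1 x.2) ∩ calTs s = ∅)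


/-- The real embedding of `ℤ[√2]` as a ring homomorphism. -/
def embHom : Zsqrtd 2 →+* ℝ where
  toFun := emb
  map_one' := by simp [emb]
  map_zero' := by simp [emb]
  map_add' a b := by simp [emb]; ring
  map_mul' a b := by
    have h : Real.sqrt 2 ^ 2 = 2 := Real.sq_sqrt (by norm_num)
    simp only [emb, Zsqrtd.re_mul, Zsqrtd.im_mul]
    push_cast
    linear_combination (-(a.im : ℝ) * b.im) * h

/-- The conjugate embedding of `ℤ[√2]` as a ring homomorphism. -/
def embcHom : Zsqrtd 2 →+* ℝ where
  toFun := embc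
  map_one' := by simp [embc]
  map_zero' := by simp [embc]
  map_add' a b := by simp [embc]; ring
  map_mul' a b := by
    have h : Real.sqrt 2 ^ 2 = 2 := Real.sq_sqrt (by norm_num)
    simp only [embc, Zsqrtd.re_mul, Zsqrtd.im_mul]
    push_cast
    linear_combination (-(a.im : ℝ) * b.im) * h

lemma embHom_apply (α : Zsqrtd 2) : embHom α = emb α := rfl

lemma embcHom_apply (α : Zsqrtd 2) : embcHom α = embc α := rfl

lemma emb_neg (α : Zsqrtd 2) : emb (-α) = -emb α := map_neg embHom α

lemma embc_neg (α : Zsqrtd 2) : embc (-α) = -embc α := map_neg embcHom α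

lemma bd_mul_bd (A B C D : Matrix (Fin 2) (Fin 2) ℝ) :
    bd A B * bd C D = bd (A * C) (B * D) := by
  ext i j
  fin_cases i <;> fin_cases j <;> simp [bd, Matrix.mul_apply, Fin.sum_univ_succ]

lemma mul_mem_GammaK {g₁ g₂ : Matrix (Fin 4) (Fin 4) ℝ} (h₁ : g₁ ∈ GammaK) (h₂ : g₂ ∈ GammaK) :
    g₁ * g₂ ∈ GammaK := by
  obtain ⟨A, hA, rfl⟩ := h₁
  obtain ⟨B, hB, rfl⟩ := h₂
  refine ⟨A * B, by rw [det_mul, hA, hB, one_mul], ?_⟩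
  rw [bd_mul_bd]
  congr 1
  · exact (Matrix.map_mul (f := embHom)).symm
  · exact (Matrix.map_mul (f := embcHom)).symm

/-- The matrix `n(x)a(y)k(θ)` written out. -/
lemma nmat_mul_amat_mul_kmat (x y θ : ℝ) :
    nmat x * amat y * kmat θ =
      !![y * Real.cos θ + x * y⁻¹ * Real.sin θ, -(y * Real.sin θ) + x * y⁻¹ * Real.cos θ;
         y⁻¹ * Real.sin θ, y⁻¹ * Real.cos θ] := by
  ext i j
  fin_cases i <;> fin_cases j <;> simp [nmat, amat, kmat, Matrix.mul_apply, Fin.sum_univ_succ]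

/-- The squared norm of the bottom row. -/
def bottomSq (A : Matrix (Fin 2) (Fin 2) ℝ) : ℝ := A 1 0 ^ 2 + A 1 1 ^ 2

lemma exists_angle_sign (z : ℂ) :
    ∃ θ ∈ Set.Ico 0 Real.pi, ∃ s : ℝ, (s = 1 ∨ s = -1) ∧
      z.re = s * (‖z‖ * Real.cos θ) ∧ z.im = s * (‖z‖ * Real.sin θ) := by
  have hre := Complex.norm_mul_cos_arg z
  have him := Complex.norm_mul_sin_arg z
  rcases lt_or_ge z.arg 0 with h | h
  · refine ⟨z.arg + Real.pi, ⟨by linarith [Complex.neg_pi_lt_arg z], by linarith⟩, -1, Or.inr rfl,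
      ?_, ?_⟩
    · rw [Real.cos_add_pi]; linarith
    · rw [Real.sin_add_pi]; linarith
  · rcases (Complex.arg_le_pi z).lt_or_eq with h' | h'
    · exact ⟨z.arg, ⟨h, h'⟩, 1, Or.inl rfl, by linarith, by linarith⟩
    · rw [h'] at hre him
      refine ⟨0, ⟨le_rfl, Real.pi_pos⟩, -1, Or.inr rfl, ?_, ?_⟩
      · rw [Real.cos_pi] at hre; rw [Real.cos_zero]; linarith
      · rw [Real.sin_pi] at him; rw [Real.sin_zero]; linarith

/-- Iwasawa decomposition in `SL₂(ℝ)`, with the angle reduced modulo `π` up to a sign. -/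
lemma exists_iwasawa_sign (A : Matrix (Fin 2) (Fin 2) ℝ) (hA : A.det = 1) :
    ∃ x y θ s : ℝ, 0 < y ∧ θ ∈ Set.Ico 0 Real.pi ∧ (s = 1 ∨ s = -1) ∧
      A = s • (nmat x * amat y * kmat θ) ∧ (y⁻¹) ^ 2 = bottomSq A := by
  rw [det_fin_two] at hA
  obtain ⟨θ, hθ, s, hs, h1, h2⟩ := exists_angle_sign ⟨A 1 1, A 1 0⟩
  simp only at h1 h2
  have hn : ‖(⟨A 1 1, A 1 0⟩ : ℂ)‖ ^ 2 = A 1 0 ^ 2 + A 1 1 ^ 2 := by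
    rw [Complex.sq_norm, Complex.normSq_mk]; ring
  set r := ‖(⟨A 1 1, A 1 0⟩ : ℂ)‖
  have hr : 0 < r := by
    refine lt_of_le_of_ne (norm_nonneg _) fun h => ?_
    rw [← h] at h1 h2
    rw [h1, h2] at hA
    simp at hA
  have hss : s ^ 2 = 1 := by rcases hs with rfl | rfl <;> norm_num
  refine ⟨(A 0 0 * A 1 0 + A 0 1 * A 1 1) / r ^ 2, r⁻¹, θ, s, inv_pos.2 hr, hθ, hs, ?_, ?_⟩
  · have hc := Real.sin_sq_add_cos_sq θ
    rw [nmat_mul_amat_mul_kmat, inv_inv]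
    set u := Real.cos θ
    set v := Real.sin θ
    have hd : A 0 0 * (s * (r * u)) - A 0 1 * (s * (r * v)) = 1 := by rw [← h1, ← h2]; exact hA
    ext i j
    fin_cases i <;> fin_cases j
    · simp
      rw [h1, h2]
      field_simp
      linear_combination (-A 0 0 * r) * hc + (s * u) * hd - (A 0 0 * r * (u ^ 2 + v ^ 2)) * hss
    · simp
      rw [h1, h2]
      field_simp
      linear_combination (-A 0 1 * r) * hc - (s * v) * hd - (A 0 1 * r * (u ^ 2 + v ^ 2)) * hss
    · simp [h2]
    · simp [h1]
  · rw [inv_inv, hn, bottomSq]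

lemma lam_pos : 0 < lam := by unfold lam; positivity

lemma sqrt_two_sq : Real.sqrt 2 ^ 2 = 2 := Real.sq_sqrt (by norm_num)

lemma one_lt_lam : 1 < lam := by
  have : 0 < Real.sqrt 2 := by positivity
  unfold lam; linarith

lemma lam_sq_lt_six : lam ^ 2 < 6 := by
  have h := sqrt_two_sq
  have h0 : 0 < Real.sqrt 2 := by positivity
  unfold lam
  nlinarith

/-- The fundamental unit as a unit of `ℤ[√2]`. -/
def lamUnit : (Zsqrtd 2)ˣ where
  val := ⟨1, 1⟩
  inv := ⟨-1, 1⟩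
  val_inv := by decide
  inv_val := by decide

lemma emb_lamUnit_zpow (k : ℤ) : emb ((lamUnit ^ k : (Zsqrtd 2)ˣ) : Zsqrtd 2) = lam ^ k := by
  have h := congrArg Units.val (map_zpow (Units.map (embHom : Zsqrtd 2 →* ℝ)) lamUnit k)
  rw [Units.val_zpow_eq_zpow_val] at h
  have h1 : ((Units.map (embHom : Zsqrtd 2 →* ℝ) lamUnit : ℝˣ) : ℝ) = lam := by
    simp [embHom_apply, emb, lamUnit, lam]
  rw [h1] at h
  exact h

lemma embc_lamUnit_zpow (k : ℤ) :
    embc ((lamUnit ^ k : (Zsqrtd 2)ˣ) : Zsqrtd 2) = (-1) ^ k * (lam ^ k)⁻¹ := by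
  have h := congrArg Units.val (map_zpow (Units.map (embcHom : Zsqrtd 2 →* ℝ)) lamUnit k)
  rw [Units.val_zpow_eq_zpow_val] at h
  have h2 : (1 - Real.sqrt 2) = -1 * lam⁻¹ := by
    have := lam_pos
    field_simp
    unfold lam
    linear_combination -sqrt_two_sq
  have h3 : ((Units.map (embcHom : Zsqrtd 2 →* ℝ) lamUnit : ℝˣ) : ℝ) = -1 * lam⁻¹ := by
    rw [← h2]; simp [embcHom_apply, embc, lamUnit, sub_eq_add_neg]
  rw [h3, mul_zpow, _root_.inv_zpow] at h
  exact h

lemma exists_zpow_four_mul_mem (ρ : ℝ) (hρ : 0 < ρ) :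
    ∃ k : ℤ, lam ^ (-2 : ℤ) ≤ (lam ^ (2 * k)) ^ 2 * ρ ∧ (lam ^ (2 * k)) ^ 2 * ρ ≤ lam ^ 2 := by
  have hl := lam_pos
  obtain ⟨n, h1, h2⟩ := exists_mem_Ico_zpow (x := ρ * lam ^ 2) (y := lam ^ 4)
    (by positivity) (one_lt_pow₀ one_lt_lam (by norm_num))
  have key : (lam ^ (2 * -n)) ^ 2 = ((lam ^ 4) ^ n)⁻¹ := by
    rw [← zpow_natCast, ← zpow_natCast, ← _root_.zpow_mul, ← _root_.zpow_mul, ← _root_.zpow_neg]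
    congr 1; push_cast; ring
  have hp : 0 < (lam ^ 4) ^ n := by positivity
  refine ⟨-n, ?_, ?_⟩
  · rw [key, _root_.zpow_neg]
    norm_cast
    field_simp
    linarith
  · rw [key]
    rw [zpow_add_one₀ (by positivity)] at h2
    field_simp
    nlinarith [pow_pos hl 2]

/-- Units of `ℤ[√2]` realise every pair of signs while bringing a ratio into `[λ⁻², λ²]`. -/
lemma exists_unit_sign (s₁ s₂ ρ : ℝ) (h₁ : s₁ = 1 ∨ s₁ = -1) (h₂ : s₂ = 1 ∨ s₂ = -1)
    (hρ : 0 < ρ) :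
    ∃ ε : (Zsqrtd 2)ˣ, ∃ μ : ℝ, 0 < μ ∧ emb ε = s₁ * μ ∧ embc ε = s₂ * μ⁻¹ ∧
      lam ^ (-2 : ℤ) ≤ μ ^ 2 * ρ ∧ μ ^ 2 * ρ ≤ lam ^ 2 := by
  have hl := lam_pos
  obtain ⟨k, hk1, hk2⟩ := exists_zpow_four_mul_mem ρ hρ
  obtain ⟨m, hm1, hm2⟩ := exists_zpow_four_mul_mem (lam ^ 2 * ρ) (by positivity)
  have hm : (lam ^ (2 * m + 1)) ^ 2 * ρ = (lam ^ (2 * m)) ^ 2 * (lam ^ 2 * ρ) := by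
    rw [zpow_add_one₀ hl.ne']; ring
  rw [← hm] at hm1 hm2
  have he := emb_lamUnit_zpow (2 * k)
  have hec := embc_lamUnit_zpow (2 * k)
  have ho := emb_lamUnit_zpow (2 * m + 1)
  have hoc := embc_lamUnit_zpow (2 * m + 1)
  rw [(even_two_mul k).neg_one_zpow] at hec
  rw [(odd_two_mul_add_one m).neg_one_zpow] at hoc
  rcases h₁ with rfl | rfl <;> rcases h₂ with rfl | rfl
  · exact ⟨_, _, by positivity, by rw [he]; ring, hec, hk1, hk2⟩
  · exact ⟨_, _, by positivity, by rw [ho]; ring, hoc, hm1, hm2⟩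
  · exact ⟨-lamUnit ^ (2 * m + 1), lam ^ (2 * m + 1), by positivity,
      by rw [Units.val_neg, emb_neg, ho]; ring,
      by rw [Units.val_neg, embc_neg, hoc]; ring, hm1, hm2⟩
  · exact ⟨-lamUnit ^ (2 * k), lam ^ (2 * k), by positivity,
      by rw [Units.val_neg, emb_neg, he]; ring,
      by rw [Units.val_neg, embc_neg, hec]; ring, hk1, hk2⟩

lemma exists_coords (x₁ x₂ : ℝ) :
    ∃ a b : ℝ, x₁ = a + b * Real.sqrt 2 ∧ x₂ = a - b * Real.sqrt 2 := by
  have h0 : Real.sqrt 2 ≠ 0 := by positivity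
  refine ⟨(x₁ + x₂) / 2, (x₁ - x₂) / (2 * Real.sqrt 2), ?_, ?_⟩ <;> field_simp <;> ring

lemma exists_add_mem_Fdom (x₁ x₂ : ℝ) : ∃ β : Zsqrtd 2, (emb β + x₁, embc β + x₂) ∈ Fdom := by
  obtain ⟨a, b, h1, h2⟩ := exists_coords (x₁ - 1) (x₂ - 2)
  refine ⟨⟨-⌊a⌋, -⌊b⌋⟩, Int.fract a, ⟨Int.fract_nonneg a, Int.fract_lt_one a⟩, Int.fract b,
    ⟨Int.fract_nonneg b, Int.fract_lt_one b⟩, ?_⟩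
  simp only [emb, embc, Int.fract, Prod.mk.injEq]
  push_cast
  constructor <;> linarith

/-- Norm-Euclidean approximation in `ℤ[√2]`. -/
lemma exists_add_small (x₁ x₂ : ℝ) :
    ∃ β : Zsqrtd 2, ((emb β + x₁) * (embc β + x₂)) ^ 2 ≤ 1 / 4 ∧
      (emb β + x₁) ^ 2 + (embc β + x₂) ^ 2 ≤ 3 / 2 := by
  obtain ⟨a, b, h1, h2⟩ := exists_coords x₁ x₂
  refine ⟨⟨-round a, -round b⟩, ?_⟩
  have ha := abs_le.1 (abs_sub_round a)
  have hb := abs_le.1 (abs_sub_round b)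
  simp only [emb, embc]
  push_cast
  have e1 : (-(round a : ℝ) + -(round b : ℝ) * Real.sqrt 2 + x₁) =
      (a - round a) + (b - round b) * Real.sqrt 2 := by rw [h1]; ring
  have e2 : (-(round a : ℝ) - -(round b : ℝ) * Real.sqrt 2 + x₂) =
      (a - round a) - (b - round b) * Real.sqrt 2 := by rw [h2]; ring
  rw [e1, e2]
  generalize a - (round a : ℝ) = u at *
  generalize b - (round b : ℝ) = v at *
  have hu : u ^ 2 ≤ 1 / 4 := by nlinarith
  have hv : v ^ 2 ≤ 1 / 4 := by nlinarith
  have hs := sqrt_two_sq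
  have e3 : (u + v * Real.sqrt 2) * (u - v * Real.sqrt 2) = u ^ 2 - 2 * v ^ 2 := by
    linear_combination (-v ^ 2) * hs
  have e4 : (u + v * Real.sqrt 2) ^ 2 + (u - v * Real.sqrt 2) ^ 2 = 2 * u ^ 2 + 4 * v ^ 2 := by
    linear_combination (2 * v ^ 2) * hs
  rw [e3, e4]
  constructor
  · nlinarith [sq_nonneg u, sq_nonneg v]
  · linarith

lemma unipotent_mem_GammaK (β : Zsqrtd 2) : bd (nmat (emb β)) (nmat (embc β)) ∈ GammaK := by
  refine ⟨!![1, β; 0, 1], by simp [det_fin_two], ?_⟩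
  congr 1 <;> ext i j <;> fin_cases i <;> fin_cases j <;> simp [nmat, emb, embc]

lemma inversion_mem_GammaK : bd !![0, -1; 1, 0] !![0, -1; 1, 0] ∈ GammaK := by
  refine ⟨!![0, -1; 1, 0], by simp [det_fin_two], ?_⟩
  congr 1 <;> ext i j <;> fin_cases i <;> fin_cases j <;> simp [emb, embc]

lemma diagonal_mem_GammaK (ε : (Zsqrtd 2)ˣ) : bd (amat (emb ε)) (amat (embc ε)) ∈ GammaK := by
  refine ⟨!![(ε : Zsqrtd 2), 0; 0, ((ε⁻¹ : (Zsqrtd 2)ˣ) : Zsqrtd 2)], by simp [det_fin_two], ?_⟩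
  have h1 : emb ((ε⁻¹ : (Zsqrtd 2)ˣ) : Zsqrtd 2) = (emb ε)⁻¹ := map_units_inv embHom ε
  have h2 : embc ((ε⁻¹ : (Zsqrtd 2)ˣ) : Zsqrtd 2) = (embc ε)⁻¹ := map_units_inv embcHom ε
  have h01 : emb 0 = 0 := map_zero embHom
  have h02 : embc 0 = 0 := map_zero embcHom
  congr 1 <;> ext i j <;> fin_cases i <;> fin_cases j <;> simp [amat, h1, h2, h01, h02]

lemma nmat_mul_iwasawa (b x y θ : ℝ) :
    nmat b * (nmat x * amat y * kmat θ) = nmat (b + x) * amat y * kmat θ := by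
  have : nmat b * nmat x = nmat (b + x) := by
    ext i j
    fin_cases i <;> fin_cases j <;> simp [nmat, Matrix.mul_apply, add_comm]
  rw [← this]; simp only [Matrix.mul_assoc]

lemma amat_mul_sign_iwasawa (s μ x y θ : ℝ) (hs : s = 1 ∨ s = -1) (hμ : 0 < μ) :
    amat (s * μ) * (s • (nmat x * amat y * kmat θ)) =
      nmat (μ ^ 2 * x) * amat (μ * y) * kmat θ := by
  have : amat (s * μ) * (s • (nmat x * amat y)) = nmat (μ ^ 2 * x) * amat (μ * y) := by
    rcases hs with rfl | rfl <;> ext i j <;> fin_cases i <;> fin_cases j <;>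
      simp [nmat, amat, Matrix.mul_apply, mul_comm] <;> field_simp
  rw [← this]; simp only [Matrix.mul_assoc, Matrix.smul_mul, Matrix.mul_smul]

/-- Every element of `H` is `Γ_K`-equivalent to one satisfying all the conditions of the Siegel
domain, except that `y₁y₂` is left unchanged. -/
lemma exists_normalized (A B : Matrix (Fin 2) (Fin 2) ℝ) (hA : A.det = 1) (hB : B.det = 1) :
    ∃ γ ∈ GammaK, ∃ x₁ x₂ y₁ y₂ θ₁ θ₂ : ℝ, (x₁, x₂) ∈ Fdom ∧ 0 < y₁ ∧ 0 < y₂ ∧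
      lam ^ (-2 : ℤ) ≤ y₁ / y₂ ∧ y₁ / y₂ ≤ lam ^ 2 ∧
      θ₁ ∈ Set.Ico 0 Real.pi ∧ θ₂ ∈ Set.Ico 0 Real.pi ∧
      γ * bd A B = hmat x₁ x₂ y₁ y₂ θ₁ θ₂ ∧
      ((y₁ * y₂)⁻¹) ^ 2 = bottomSq A * bottomSq B := by
  obtain ⟨x₁, y₁, θ₁, s₁, hy₁, hθ₁, hs₁, hA', hb₁⟩ := exists_iwasawa_sign A hA
  obtain ⟨x₂, y₂, θ₂, s₂, hy₂, hθ₂, hs₂, hB', hb₂⟩ := exists_iwasawa_sign B hB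
  obtain ⟨ε, μ, hμ, he, hec, hr1, hr2⟩ := exists_unit_sign s₁ s₂ (y₁ / y₂) hs₁ hs₂ (by positivity)
  obtain ⟨β, hβ⟩ := exists_add_mem_Fdom (μ ^ 2 * x₁) (μ⁻¹ ^ 2 * x₂)
  have hratio : μ * y₁ / (μ⁻¹ * y₂) = μ ^ 2 * (y₁ / y₂) := by field_simp
  refine ⟨_, mul_mem_GammaK (unipotent_mem_GammaK β) (diagonal_mem_GammaK ε), _, _,
    μ * y₁, μ⁻¹ * y₂, θ₁, θ₂, hβ, by positivity, by positivity, by rwa [hratio], by rwa [hratio],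
    hθ₁, hθ₂, ?_, ?_⟩
  · rw [Matrix.mul_assoc, bd_mul_bd, bd_mul_bd, he, hec, hA', hB',
      amat_mul_sign_iwasawa _ _ _ _ _ hs₁ hμ,
      amat_mul_sign_iwasawa _ _ _ _ _ hs₂ (inv_pos.2 hμ), nmat_mul_iwasawa, nmat_mul_iwasawa, hmat]
  · rw [← hb₁, ← hb₂]; field_simp

lemma bottomSq_inversion_iwasawa (x y θ : ℝ) :
    bottomSq (!![0, -1; 1, 0] * (nmat x * amat y * kmat θ)) = y ^ 2 + x ^ 2 * (y⁻¹) ^ 2 := by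
  rw [nmat_mul_amat_mul_kmat]
  simp only [bottomSq, Matrix.mul_apply, Fin.sum_univ_two]
  simp
  linear_combination (y ^ 2 + x ^ 2 * (y⁻¹) ^ 2) * Real.sin_sq_add_cos_sq θ

lemma det_inversion_iwasawa (x y θ : ℝ) (hy : 0 < y) :
    (!![0, -1; 1, 0] * (nmat x * amat y * kmat θ)).det = 1 := by
  simp only [det_mul]
  have := Real.sin_sq_add_cos_sq θ
  simp [nmat, amat, kmat, det_fin_two, hy.ne']
  linarith

/-- If `y₁y₂` is small, inversion after a suitable translation increases it by a fixed factor. -/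
lemma exists_bottomSq_le_half (x₁ x₂ y₁ y₂ θ₁ θ₂ : ℝ) (hy₁ : 0 < y₁) (hy₂ : 0 < y₂)
    (hr1 : lam ^ (-2 : ℤ) ≤ y₁ / y₂) (hr2 : y₁ / y₂ ≤ lam ^ 2) (hp : y₁ * y₂ < 1 / 20) :
    ∃ γ ∈ GammaK, ∃ A B : Matrix (Fin 2) (Fin 2) ℝ, A.det = 1 ∧ B.det = 1 ∧
      γ * hmat x₁ x₂ y₁ y₂ θ₁ θ₂ = bd A B ∧
      bottomSq A * bottomSq B ≤ ((y₁ * y₂)⁻¹) ^ 2 / 2 := by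
  obtain ⟨β, hβ1, hβ2⟩ := exists_add_small x₁ x₂
  refine ⟨_, mul_mem_GammaK inversion_mem_GammaK (unipotent_mem_GammaK β), _, _,
    det_inversion_iwasawa (emb β + x₁) y₁ θ₁ hy₁, det_inversion_iwasawa (embc β + x₂) y₂ θ₂ hy₂,
    ?_, ?_⟩
  · rw [Matrix.mul_assoc, hmat, bd_mul_bd, bd_mul_bd, nmat_mul_iwasawa, nmat_mul_iwasawa]
  · rw [bottomSq_inversion_iwasawa, bottomSq_inversion_iwasawa]
    generalize emb β + x₁ = u at *
    generalize embc β + x₂ = v at *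
    have hl := lam_sq_lt_six
    have hlp := lam_pos
    have ha : y₁ ≤ 6 * y₂ := by
      rw [div_le_iff₀ hy₂] at hr2; nlinarith
    have hb : y₂ ≤ 6 * y₁ := by
      rw [_root_.zpow_neg, le_div_iff₀ hy₂] at hr1
      norm_cast at hr1
      rw [inv_mul_le_iff₀ (by positivity)] at hr1
      nlinarith
    have ha2 : y₁ ^ 2 ≤ 3 / 10 := by nlinarith
    have hb2 : y₂ ^ 2 ≤ 3 / 10 := by nlinarith
    have ha4 : y₁ ^ 4 ≤ 9 / 100 := by nlinarith [sq_nonneg y₁]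
    have hb4 : y₂ ^ 4 ≤ 9 / 100 := by nlinarith [sq_nonneg y₂]
    have hab : y₁ ^ 4 * y₂ ^ 4 ≤ 9 / 100 * (9 / 100) := by gcongr
    have hav : y₁ ^ 4 * v ^ 2 ≤ 9 / 100 * v ^ 2 := by gcongr
    have hbu : y₂ ^ 4 * u ^ 2 ≤ 9 / 100 * u ^ 2 := by gcongr
    have key : (y₁ ^ 4 + u ^ 2) * (y₂ ^ 4 + v ^ 2) ≤ 1 / 2 := by nlinarith
    have e : (y₁ ^ 2 + u ^ 2 * y₁⁻¹ ^ 2) * (y₂ ^ 2 + v ^ 2 * y₂⁻¹ ^ 2) =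
        ((y₁ ^ 4 + u ^ 2) * (y₂ ^ 4 + v ^ 2)) * ((y₁ * y₂)⁻¹) ^ 2 := by field_simp
    rw [e]
    have := mul_le_mul_of_nonneg_right key (sq_nonneg (y₁ * y₂)⁻¹)
    linarith

lemma exists_mem_Dset (n : ℕ) : ∀ A B : Matrix (Fin 2) (Fin 2) ℝ, A.det = 1 → B.det = 1 →
    bottomSq A * bottomSq B ≤ 400 * 2 ^ n → ∃ γ ∈ GammaK, γ * bd A B ∈ Dset (1 / 20) := by
  induction n with
  | zero =>
    intro A B hA hB hP
    obtain ⟨γ, hγ, x₁, x₂, y₁, y₂, θ₁, θ₂, hx, hy₁, hy₂, hr1, hr2, hθ₁, hθ₂, heq, hP'⟩ :=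
      exists_normalized A B hA hB
    refine ⟨γ, hγ, x₁, x₂, y₁, y₂, θ₁, θ₂, hx, hy₁, hy₂, ?_, hr1, hr2, hθ₁, hθ₂, heq⟩
    have hp : 0 < y₁ * y₂ := by positivity
    have h20 : (y₁ * y₂)⁻¹ ≤ 20 := by nlinarith [inv_pos.2 hp]
    rw [inv_le_comm₀ hp (by norm_num)] at h20
    linarith
  | succ n ih =>
    intro A B hA hB hP
    obtain ⟨γ, hγ, x₁, x₂, y₁, y₂, θ₁, θ₂, hx, hy₁, hy₂, hr1, hr2, hθ₁, hθ₂, heq, hP'⟩ :=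
      exists_normalized A B hA hB
    rcases le_or_gt (1 / 20) (y₁ * y₂) with hp | hp
    · exact ⟨γ, hγ, x₁, x₂, y₁, y₂, θ₁, θ₂, hx, hy₁, hy₂, hp, hr1, hr2, hθ₁, hθ₂, heq⟩
    · obtain ⟨δ, hδ, A', B', hA', hB', heq', hle⟩ :=
        exists_bottomSq_le_half x₁ x₂ y₁ y₂ θ₁ θ₂ hy₁ hy₂ hr1 hr2 hp
      obtain ⟨η, hη, hmem⟩ := ih A' B' hA' hB' (by rw [hP'] at hle; rw [pow_succ] at hP; linarith)
      refine ⟨η * (δ * γ), mul_mem_GammaK hη (mul_mem_GammaK hδ hγ), ?_⟩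
      rwa [Matrix.mul_assoc, Matrix.mul_assoc, heq, heq']

/-- there is t > 0 with Γ_K · 𝔇_t = H. -/
theorem stmt1 : ∃ t > (0:ℝ), ∀ h ∈ Hset, ∃ γ ∈ GammaK, γ * h ∈ Dset t := by
  refine ⟨1 / 20, by norm_num, ?_⟩
  rintro h ⟨A, B, hA, hB, rfl⟩
  obtain ⟨n, hn⟩ := pow_unbounded_of_one_lt (bottomSq A * bottomSq B) (one_lt_two (α := ℝ))
  refine exists_mem_Dset n A B hA hB ?_
  linarith [pow_pos (two_pos (α := ℝ)) n]

end
end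

section
/- For every t > 0 there exists s₀ > 0 such that for all s ≥ s₀: G_M(s) = C_𝒫/s, where C_𝒫 = 2304(2−√2)/π⁸; equivalently C_𝒫 = (√2−1)/(√2·ζ_K(2)²) with ζ_K(2) = π⁴/(48√2) the value at 2 of the Dedekind zeta function of K = ℚ(√2). -/
open MeasureTheory Matrix Set Pointwise

noncomputable section

/-- No nonzero `m + n√2` has absolute value below `a` and conjugate of absolute value below `b`. -/
def BoxFree (a b : ℝ) : Prop :=
  ∀ m n : ℤ, |(m : ℝ) + n * √2| < a → |(m : ℝ) - n * √2| < b → m = 0 ∧ n = 0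

lemma lam_sq : lam ^ 2 = 2 * lam + 1 := by
  have := Real.sq_sqrt (show (0 : ℝ) ≤ 2 by norm_num)
  unfold lam; linear_combination this

lemma inv_lam : lam⁻¹ = √2 - 1 := by
  have := Real.sq_sqrt (show (0 : ℝ) ≤ 2 by norm_num)
  exact inv_eq_of_mul_eq_one_right (by unfold lam; linear_combination this)

lemma sqrt_two_bounds : 1.414 < √2 ∧ √2 < 1.415 := by
  constructor
  · exact Real.lt_sqrt_of_sq_lt (by norm_num)
  · exact (Real.sqrt_lt' (by norm_num)).2 (by norm_num)

/-- Multiplication by `λ` on `ℤ[√2]` preserves `BoxFree`. -/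
lemma BoxFree.of_lam_mul {a b : ℝ} (h : BoxFree (lam * a) (lam⁻¹ * b)) : BoxFree a b := by
  intro m n h₁ h₂
  have h2 := Real.mul_self_sqrt (show (0 : ℝ) ≤ 2 by norm_num)
  have key := h (m + 2 * n) (m + n) ?_ ?_
  · omega
  · have : ((m + 2 * n : ℤ) : ℝ) + ((m + n : ℤ) : ℝ) * √2 = lam * (m + n * √2) := by
      push_cast; unfold lam; linear_combination -(n : ℝ) * h2
    rw [this, abs_mul, abs_of_pos lam_pos]
    exact mul_lt_mul_of_pos_left h₁ lam_pos
  · have : ((m + 2 * n : ℤ) : ℝ) - ((m + n : ℤ) : ℝ) * √2 = -lam⁻¹ * (m - n * √2) := by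
      rw [inv_lam]; push_cast; linear_combination -(n : ℝ) * h2
    rw [this, abs_mul, abs_neg, abs_of_pos (inv_pos.2 lam_pos)]
    exact mul_lt_mul_of_pos_left h₂ (inv_pos.2 lam_pos)

lemma BoxFree.of_inv_lam_mul {a b : ℝ} (h : BoxFree (lam⁻¹ * a) (lam * b)) : BoxFree a b := by
  intro m n h₁ h₂
  have h2 := Real.mul_self_sqrt (show (0 : ℝ) ≤ 2 by norm_num)
  have key := h (2 * n - m) (m - n) ?_ ?_
  · omega
  · have : ((2 * n - m : ℤ) : ℝ) + ((m - n : ℤ) : ℝ) * √2 = lam⁻¹ * (m + n * √2) := by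
      rw [inv_lam]; push_cast; linear_combination -(n : ℝ) * h2
    rw [this, abs_mul, abs_of_pos (inv_pos.2 lam_pos)]
    exact mul_lt_mul_of_pos_left h₁ (inv_pos.2 lam_pos)
  · have : ((2 * n - m : ℤ) : ℝ) - ((m - n : ℤ) : ℝ) * √2 = -lam * (m - n * √2) := by
      unfold lam; push_cast; linear_combination -(n : ℝ) * h2
    rw [this, abs_mul, abs_neg, abs_of_pos lam_pos]
    exact mul_lt_mul_of_pos_left h₂ lam_pos

lemma boxFree_lam_mul_iff (a b : ℝ) : BoxFree (lam * a) (lam⁻¹ * b) ↔ BoxFree a b := by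
  refine ⟨BoxFree.of_lam_mul, fun h => BoxFree.of_inv_lam_mul ?_⟩
  rwa [inv_mul_cancel_left₀ lam_pos.ne', mul_inv_cancel_left₀ lam_pos.ne']

lemma boxFree_lam_zpow_mul_iff (k : ℤ) (a b : ℝ) :
    BoxFree (lam ^ k * a) (lam ^ (-k) * b) ↔ BoxFree a b := by
  have h0 := lam_pos.ne'
  induction k with
  | zero => simp
  | succ i ih =>
    refine Iff.trans ?_ ih
    rw [← boxFree_lam_mul_iff (lam ^ (i : ℤ) * a), _root_.zpow_add_one₀ h0, neg_add,
      _root_.zpow_add₀ h0, _root_.zpow_neg_one]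
    ring_nf
  | pred i ih =>
    refine Iff.trans ?_ ih
    rw [← boxFree_lam_mul_iff (lam ^ (-(i : ℤ) - 1) * a), _root_.zpow_sub_one₀ h0, neg_sub,
      sub_neg_eq_add, _root_.zpow_add₀ h0, _root_.zpow_one, neg_neg]
    have e₁ : lam * (lam ^ (-(i : ℤ)) * lam⁻¹ * a) = lam ^ (-(i : ℤ)) * a := by field_simp
    have e₂ : lam⁻¹ * (lam * lam ^ (i : ℤ) * b) = lam ^ (i : ℤ) * b := by field_simp
    rw [e₁, e₂]

lemma boxFree_one_lam : BoxFree 1 lam ∧ BoxFree lam 1 := by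
  obtain ⟨l, u⟩ := sqrt_two_bounds
  have key : ∀ m n : ℤ, |(m : ℝ)| < 1.71 → |(n : ℝ)| * √2 < 1.71 →
      (m = -1 ∨ m = 0 ∨ m = 1) ∧ (n = -1 ∨ n = 0 ∨ n = 1) := by
    intro m n hm hn
    have hm' : |m| < 2 := by
      have : (|m| : ℝ) < 2 := by linarith
      exact_mod_cast this
    have hn' : |n| < 2 := by
      have : (|n| : ℝ) < 2 := by nlinarith [abs_nonneg (n : ℝ)]
      exact_mod_cast this
    rw [abs_lt] at hm' hn'
    omega
  constructor <;> intro m n h₁ h₂ <;> simp only [lam, abs_lt] at h₁ h₂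
  all_goals
    obtain ⟨hm, hn⟩ := key m n (by rw [abs_lt]; constructor <;> linarith)
      (by
        rw [show |(n : ℝ)| * √2 = |(n : ℝ) * √2| by
          rw [abs_mul, abs_of_pos (show 0 < √2 by positivity)], abs_lt]
        constructor <;> linarith)
    rcases hm with rfl | rfl | rfl <;> rcases hn with rfl | rfl | rfl <;>
      first
      | exact ⟨rfl, rfl⟩
      | (exfalso; push_cast at h₁ h₂; linarith [h₁.1, h₁.2, h₂.1, h₂.2])

lemma BoxFree.mono {a b a' b' : ℝ} (h : BoxFree a b) (ha : a' ≤ a) (hb : b' ≤ b) :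
    BoxFree a' b' :=
  fun m n h₁ h₂ => h m n (h₁.trans_le ha) (h₂.trans_le hb)

lemma BoxFree.le_one_or_le_one {a b : ℝ} (h : BoxFree a b) : a ≤ 1 ∨ b ≤ 1 := by
  by_contra! hc
  simpa using h 1 0 (by simpa using hc.1) (by simpa using hc.2)

lemma boxFree_iff_right {a b : ℝ} (h₁ : b ≤ a) (h₂ : a ≤ lam * b) : BoxFree a b ↔ b ≤ 1 := by
  refine ⟨fun h => h.le_one_or_le_one.elim h₁.trans id, fun h => ?_⟩
  exact boxFree_one_lam.2.mono (h₂.trans (mul_le_of_le_one_right lam_pos.le h)) h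

lemma boxFree_iff_left {a b : ℝ} (h₁ : a ≤ b) (h₂ : b ≤ lam * a) : BoxFree a b ↔ a ≤ 1 := by
  refine ⟨fun h => h.le_one_or_le_one.elim id h₁.trans, fun h => ?_⟩
  exact boxFree_one_lam.1.mono h (h₂.trans (mul_le_of_le_one_right lam_pos.le h))

lemma BoxFree.mul_le_lam {a b : ℝ} (hb : 0 < b) (h : BoxFree a b) : a * b ≤ lam := by
  obtain ⟨k, hk₁, hk₂⟩ := exists_mem_Ioc_zpow hb one_lt_lam
  have hp := zpow_pos lam_pos k
  have h' := ((boxFree_lam_zpow_mul_iff k a b).2 h).le_one_or_le_one.resolve_right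
    (by
      rw [not_le, _root_.zpow_neg, inv_mul_eq_div, lt_div_iff₀ hp]
      simpa using hk₁)
  rw [_root_.zpow_add_one₀ lam_pos.ne'] at hk₂
  rcases le_or_gt a 0 with ha | ha
  · exact (mul_nonpos_of_nonpos_of_nonneg ha hb.le).trans lam_pos.le
  calc a * b ≤ a * (lam ^ k * lam) := by gcongr
    _ = (lam ^ k * a) * lam := by ring
    _ ≤ 1 * lam := by gcongr; exact lam_pos.le
    _ = lam := one_mul _

/-- The weight `y₁⁻³y₂⁻³`, as an extended nonnegative real. -/
def cuspWeight (y : ℝ × ℝ) : ENNReal := ENNReal.ofReal (y.1 ^ 3 * y.2 ^ 3)⁻¹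

lemma measurable_cuspWeight : Measurable cuspWeight := by
  unfold cuspWeight; fun_prop

lemma lintegral_Ioc_cube_inv {p q : ℝ} (hp : 0 < p) (hpq : p ≤ q) :
    ∫⁻ x in Ioc p q, ENNReal.ofReal (x ^ 3)⁻¹ = ENNReal.ofReal (((p ^ 2)⁻¹ - (q ^ 2)⁻¹) / 2) := by
  have hd : ∀ x ∈ uIcc p q, HasDerivAt (fun x : ℝ => -(x ^ 2)⁻¹ / 2) (x ^ 3)⁻¹ x := by
    intro x hx
    rw [uIcc_of_le hpq] at hx
    have hx0 : x ≠ 0 := (hp.trans_le hx.1).ne'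
    have := (((hasDerivAt_pow 2 x).inv (pow_ne_zero 2 hx0)).neg).div_const 2
    refine this.congr_deriv ?_
    field_simp; norm_num; ring
  have hi : IntervalIntegrable (fun x : ℝ => (x ^ 3)⁻¹) volume p q := by
    apply ContinuousOn.intervalIntegrable
    rw [uIcc_of_le hpq]
    exact ContinuousOn.inv₀ (by fun_prop) fun x hx => pow_ne_zero 3 (hp.trans_le hx.1).ne'
  have h := intervalIntegral.integral_eq_sub_of_hasDerivAt hd hi
  rw [intervalIntegral.integral_of_le hpq] at h
  rw [← ofReal_integral_eq_lintegral_ofReal hi.1, h]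
  · congr 1; ring
  · refine (ae_restrict_iff' measurableSet_Ioc).2 (.of_forall fun x hx => ?_)
    have : 0 < x := hp.trans hx.1
    simp only [Pi.zero_apply]; positivity

lemma lintegral_Ioi_pow_five_inv {β C : ℝ} (hβ : 0 < β) (hC : 0 ≤ C) :
    ∫⁻ x in Ioi β, ENNReal.ofReal (C * (x ^ 5)⁻¹) = ENNReal.ofReal (C / (4 * β ^ 4)) := by
  have hd : ∀ x ∈ Ici β, HasDerivAt (fun x : ℝ => C * (-(x ^ 4)⁻¹ / 4)) (C * (x ^ 5)⁻¹) x := by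
    intro x hx
    have hx0 : x ≠ 0 := (hβ.trans_le hx).ne'
    have := ((((hasDerivAt_pow 4 x).inv (pow_ne_zero 4 hx0)).neg).div_const 4).const_mul C
    refine this.congr_deriv ?_
    field_simp; norm_num; ring
  have hpos : ∀ x ∈ Ioi β, 0 ≤ C * (x ^ 5)⁻¹ := by
    intro x hx
    have : 0 < x := hβ.trans hx
    positivity
  have hlim : Filter.Tendsto (fun x : ℝ => C * (-(x ^ 4)⁻¹ / 4)) Filter.atTop (nhds 0) := by
    have h1 : Filter.Tendsto (fun x : ℝ => (x ^ 4)⁻¹) Filter.atTop (nhds 0) :=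
      (Filter.tendsto_pow_atTop (by norm_num)).inv_tendsto_atTop
    simpa using (h1.neg.div_const 4).const_mul C
  have h := integral_Ioi_of_hasDerivAt_of_nonneg' hd hpos hlim
  rw [← ofReal_integral_eq_lintegral_ofReal (integrableOn_Ioi_deriv_of_nonneg' hd hpos hlim), h]
  · congr 1; field_simp; ring
  · exact (ae_restrict_iff' measurableSet_Ioi).2 (.of_forall hpos)

/-- The weighted area of a truncated sector, with either boundary convention. -/
lemma setLIntegral_cuspWeight_sector {β v₁ v₂ : ℝ} (hβ : 0 < β) (hv : 0 < v₁) (hvv : v₁ ≤ v₂)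
    {S : Set (ℝ × ℝ)} (hS : MeasurableSet S)
    (h₁ : ∀ y, β < y → {x | (x, y) ∈ S} =ᵐ[volume] Ioc (v₁ * y) (v₂ * y))
    (h₂ : ∀ x y, y < β → (x, y) ∉ S) :
    ∫⁻ y in S, cuspWeight y = ENNReal.ofReal (((v₁ ^ 2)⁻¹ - (v₂ ^ 2)⁻¹) / (8 * β ^ 4)) := by
  have hm : Measurable (S.indicator cuspWeight) := measurable_cuspWeight.indicator hS
  have hv2 : 0 < v₂ := hv.trans_le hvv
  rw [← lintegral_indicator hS, Measure.volume_eq_prod, lintegral_prod_symm' _ hm]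
  set C := ((v₁ ^ 2)⁻¹ - (v₂ ^ 2)⁻¹) / 2 with hC
  have hC0 : 0 ≤ C := by
    have : (v₂ ^ 2)⁻¹ ≤ (v₁ ^ 2)⁻¹ := by gcongr
    rw [hC]; linarith
  have key : ∀ᵐ y : ℝ, ∫⁻ x, S.indicator cuspWeight (x, y) =
      (Ioi β).indicator (fun y => ENNReal.ofReal (C * (y ^ 5)⁻¹)) y := by
    have : ∀ᵐ y : ℝ, y ≠ β := by simp [ae_iff]
    filter_upwards [this] with y hy
    rcases hy.lt_or_gt with h | h
    · rw [indicator_of_notMem (by simpa using h.le)]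
      simp [indicator, h₂ _ y h]
    · have hy0 : 0 < y := hβ.trans h
      rw [indicator_of_mem (by simpa using h)]
      have hms : MeasurableSet {x | (x, y) ∈ S} := measurable_prodMk_right hS
      have e : ∀ x, S.indicator cuspWeight (x, y) =
          {x | (x, y) ∈ S}.indicator (fun x => cuspWeight (x, y)) x := fun x => rfl
      simp_rw [e]
      rw [lintegral_indicator hms, setLIntegral_congr (h₁ y h)]
      have e' : ∀ x ∈ Ioc (v₁ * y) (v₂ * y), cuspWeight (x, y) =
          ENNReal.ofReal (x ^ 3)⁻¹ * ENNReal.ofReal (y ^ 3)⁻¹ := by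
        intro x hx
        have : 0 < x := (mul_pos hv hy0).trans hx.1
        rw [cuspWeight, mul_inv, ENNReal.ofReal_mul (by positivity)]
      rw [setLIntegral_congr_fun measurableSet_Ioc e', lintegral_mul_const _ (by fun_prop),
        lintegral_Ioc_cube_inv (mul_pos hv hy0) (by gcongr), ← ENNReal.ofReal_mul' (by positivity)]
      congr 1
      rw [hC]; field_simp
  rw [lintegral_congr_ae key, lintegral_indicator measurableSet_Ioi,
    lintegral_Ioi_pow_five_inv hβ hC0]
  congr 1
  rw [hC]; field_simp; ring

lemma measurableSet_boxFree : MeasurableSet {p : ℝ × ℝ | BoxFree p.1 p.2} := by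
  have : {p : ℝ × ℝ | BoxFree p.1 p.2} = ⋂ (m : ℤ) (n : ℤ),
      ({p : ℝ × ℝ | |(m : ℝ) + n * √2| < p.1} ∩ {p : ℝ × ℝ | |(m : ℝ) - n * √2| < p.2})ᶜ ∪
        {_p | m = 0 ∧ n = 0} := by
    ext p
    simp only [BoxFree, mem_ofPred_eq, mem_iInter, mem_union, mem_compl_iff, mem_inter_iff]
    refine forall_congr' fun m => forall_congr' fun n => ?_
    tauto
  rw [this]
  refine .iInter fun m => .iInter fun n => .union (.compl (.inter ?_ ?_)) (.const _)
  · exact measurableSet_lt measurable_const measurable_fst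
  · exact measurableSet_lt measurable_const measurable_snd

/-- The points of the sector `v₁ < y₁/y₂ ≤ v₂` for which the box `A/y₁, B/y₂` is free. -/
def freeSector (A B v₁ v₂ : ℝ) : Set (ℝ × ℝ) :=
  {y | 0 < y.2 ∧ v₁ * y.2 < y.1 ∧ y.1 ≤ v₂ * y.2 ∧ BoxFree (A / y.1) (B / y.2)}

lemma measurableSet_freeSector (A B v₁ v₂ : ℝ) : MeasurableSet (freeSector A B v₁ v₂) := by
  refine .inter (measurableSet_lt measurable_const measurable_snd) (.inter ?_ (.inter ?_ ?_))
  · exact measurableSet_lt (measurable_snd.const_mul _) measurable_fst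
  · exact measurableSet_le measurable_fst (measurable_snd.const_mul _)
  · exact measurableSet_boxFree.preimage
      (f := fun y : ℝ × ℝ => (A / y.1, B / y.2)) (by fun_prop)

/-- The weighted area of `freeSector`. -/
def freeMass (A B v₁ v₂ : ℝ) : ENNReal := ∫⁻ y in freeSector A B v₁ v₂, cuspWeight y

lemma freeMass_add {A B v₁ v₂ v₃ : ℝ} (h₁ : v₁ ≤ v₂) (h₂ : v₂ ≤ v₃) :
    freeMass A B v₁ v₂ + freeMass A B v₂ v₃ = freeMass A B v₁ v₃ := by
  have hd : Disjoint (freeSector A B v₁ v₂) (freeSector A B v₂ v₃) :=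
    Set.disjoint_left.2 fun y hy hy' => absurd hy.2.2.1 (not_le.2 hy'.2.1)
  have hu : freeSector A B v₁ v₂ ∪ freeSector A B v₂ v₃ = freeSector A B v₁ v₃ := by
    ext y
    constructor
    · rintro (⟨a, b, c, d⟩ | ⟨a, b, c, d⟩)
      · exact ⟨a, b, c.trans (by gcongr), d⟩
      · exact ⟨a, lt_of_le_of_lt (by gcongr) b, c, d⟩
    · rintro ⟨a, b, c, d⟩
      rcases le_or_gt y.1 (v₂ * y.2) with h | h
      · exact .inl ⟨a, b, h, d⟩
      · exact .inr ⟨a, h, c, d⟩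
  rw [freeMass, freeMass, freeMass, ← lintegral_union (measurableSet_freeSector ..) hd, hu]

lemma measurePreserving_scale {l : ℝ} (hl : l ≠ 0) :
    MeasurePreserving (fun y : ℝ × ℝ => (l * y.1, l⁻¹ * y.2)) := by
  have h : MeasurePreserving (Matrix.toLin (Module.Basis.finTwoProd ℝ) (Module.Basis.finTwoProd ℝ)
      !![l, 0; 0, l⁻¹]) := by
    have hdet : LinearMap.det (Matrix.toLin (Module.Basis.finTwoProd ℝ) (Module.Basis.finTwoProd ℝ)
        !![l, 0; 0, l⁻¹]) = 1 := by
      rw [LinearMap.det_toLin]; simp [hl]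
    refine ⟨(LinearMap.continuous_of_finiteDimensional _).measurable, ?_⟩
    rw [Measure.map_linearMap_addHaar_eq_smul_addHaar _ (by rw [hdet]; exact one_ne_zero), hdet]
    simp
  convert h using 1
  ext y <;> simp [Matrix.toLin_finTwoProd_apply]

lemma freeMass_lam_sq (A B v₁ v₂ : ℝ) :
    freeMass A B (lam ^ 2 * v₁) (lam ^ 2 * v₂) = freeMass A B v₁ v₂ := by
  have hl := lam_pos
  rw [freeMass, freeMass, ← (measurePreserving_scale hl.ne').setLIntegral_comp_preimage
    (measurableSet_freeSector ..) measurable_cuspWeight]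
  congr 1
  · congr 1
    ext y
    simp only [freeSector, mem_preimage, mem_ofPred_eq]
    have e₁ : lam ^ 2 * v₁ * (lam⁻¹ * y.2) = lam * (v₁ * y.2) := by field_simp
    have e₂ : lam ^ 2 * v₂ * (lam⁻¹ * y.2) = lam * (v₂ * y.2) := by field_simp
    have e₃ : A / y.1 = lam * (A / (lam * y.1)) := by field_simp
    have e₄ : B / y.2 = lam⁻¹ * (B / (lam⁻¹ * y.2)) := by field_simp
    rw [e₁, e₂, e₃, e₄, boxFree_lam_mul_iff, mul_lt_mul_iff_right₀ hl, mul_le_mul_iff_right₀ hl,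
      mul_pos_iff_of_pos_left (inv_pos.2 hl)]
  · funext y
    simp only [cuspWeight]
    congr 2
    field_simp

lemma freeMass_lam_zpow (k : ℤ) (A B v₁ v₂ : ℝ) :
    freeMass (lam ^ k * A) (lam ^ (-k) * B) v₁ v₂ = freeMass A B v₁ v₂ := by
  have : freeSector (lam ^ k * A) (lam ^ (-k) * B) v₁ v₂ = freeSector A B v₁ v₂ := by
    ext y
    simp only [freeSector, mem_ofPred_eq, mul_div_assoc, boxFree_lam_zpow_mul_iff]
  rw [freeMass, this, freeMass]

lemma freeMass_lower {A B : ℝ} (hA : 0 < A) (hB : 0 < B) :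
    freeMass A B (A / B / lam) (A / B) = ENNReal.ofReal (lam / (4 * (A ^ 2 * B ^ 2))) := by
  have hl := lam_pos
  have hc : 0 < A / B := div_pos hA hB
  have key : ∀ x y : ℝ, (x, y) ∈ freeSector A B (A / B / lam) (A / B) ↔
      B ≤ y ∧ x ∈ Ioc (A / B / lam * y) (A / B * y) := by
    intro x y
    have main : 0 < y → A / B / lam * y < x → x ≤ A / B * y →
        (BoxFree (A / x) (B / y) ↔ B ≤ y) := by
      intro hy h₁ h₂
      have hx : 0 < x := (by positivity : 0 < A / B / lam * y).trans h₁
      rw [boxFree_iff_right, div_le_one hy]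
      · rw [div_le_div_iff₀ hy hx]
        rw [div_mul_eq_mul_div, le_div_iff₀ hB] at h₂
        linarith
      · rw [← mul_div_assoc, div_le_div_iff₀ hx hy]
        rw [div_div, div_mul_eq_mul_div, div_lt_iff₀ (by positivity)] at h₁
        linarith
    constructor
    · rintro ⟨a, b, c, d⟩
      exact ⟨(main a b c).1 d, b, c⟩
    · rintro ⟨a, b, c⟩
      exact ⟨hB.trans_le a, b, c, (main (hB.trans_le a) b c).2 a⟩
  rw [freeMass, setLIntegral_cuspWeight_sector hB (by positivity)
    (div_le_self hc.le one_lt_lam.le) (measurableSet_freeSector ..) (v₂ := A / B)]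
  · congr 1
    have : lam ^ 2 - 1 = 2 * lam := by rw [lam_sq]; ring
    field_simp
    linear_combination 4 * this
  · intro y hy
    have : {x | (x, y) ∈ freeSector A B (A / B / lam) (A / B)} =
        Ioc (A / B / lam * y) (A / B * y) := by
      ext x
      simp only [mem_ofPred_eq, key, hy.le, true_and]
    rw [this]
    exact ae_eq_refl _
  · intro x y hy h
    exact absurd ((key x y).1 h).1 (not_le.2 hy)

lemma freeMass_upper {A B : ℝ} (hA : 0 < A) (hB : 0 < B) :
    freeMass A B (A / B) (lam * (A / B)) = ENNReal.ofReal (lam / (4 * (A ^ 2 * B ^ 2))) := by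
  have hl := lam_pos
  have key : ∀ x y : ℝ, (x, y) ∈ freeSector A B (A / B) (lam * (A / B)) ↔
      A ≤ x ∧ y ∈ Ico (B / A / lam * x) (B / A * x) := by
    intro x y
    have e₁ : A / B * y < x ↔ y < B / A * x := by
      rw [div_mul_eq_mul_div, div_mul_eq_mul_div, div_lt_iff₀ hB, lt_div_iff₀ hA]
      constructor <;> intro h <;> linarith
    have e₂ : x ≤ lam * (A / B) * y ↔ B / A / lam * x ≤ y := by
      rw [div_div, div_mul_eq_mul_div, div_le_iff₀ (by positivity), ← mul_div_assoc,
        div_mul_eq_mul_div, le_div_iff₀ hB]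
      constructor <;> intro h <;> linarith
    have main : 0 < x → 0 < y → B / A / lam * x ≤ y → y < B / A * x →
        (BoxFree (A / x) (B / y) ↔ A ≤ x) := by
      intro hx hy h₁ h₂
      rw [boxFree_iff_left, div_le_one hx]
      · rw [div_le_div_iff₀ hx hy]
        rw [div_mul_eq_mul_div, lt_div_iff₀ hA] at h₂
        linarith
      · rw [← mul_div_assoc, div_le_div_iff₀ hy hx]
        rw [div_div, div_mul_eq_mul_div, div_le_iff₀ (by positivity)] at h₁
        linarith
    simp only [freeSector, mem_ofPred_eq, e₁, e₂, mem_Ico]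
    constructor
    · rintro ⟨a, b, c, d⟩
      have hx : 0 < x := (by positivity : 0 < A / B * y).trans (e₁.2 b)
      exact ⟨(main hx a c b).1 d, c, b⟩
    · rintro ⟨a, b, c⟩
      have hx := hA.trans_le a
      have hy : 0 < y := (by positivity : 0 < B / A / lam * x).trans_le b
      exact ⟨hy, c, b, (main hx hy b c).2 a⟩
  have hsw : freeMass A B (A / B) (lam * (A / B)) =
      ∫⁻ y in Prod.swap ⁻¹' freeSector A B (A / B) (lam * (A / B)), cuspWeight y := by
    have hp : MeasurePreserving (Prod.swap : ℝ × ℝ → ℝ × ℝ) := Measure.measurePreserving_swap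
    rw [freeMass, ← hp.setLIntegral_comp_preimage
      (measurableSet_freeSector ..) measurable_cuspWeight]
    congr 1
    funext y
    simp [cuspWeight, mul_comm]
  rw [hsw, setLIntegral_cuspWeight_sector hA (v₁ := B / A / lam) (v₂ := B / A) (by positivity)
    (div_le_self (by positivity) one_lt_lam.le)
    ((measurableSet_freeSector ..).preimage measurable_swap)]
  · congr 1
    have : lam ^ 2 - 1 = 2 * lam := by rw [lam_sq]; ring
    field_simp
    linear_combination 4 * this
  · intro x hx
    have : {y | (y, x) ∈ Prod.swap ⁻¹' freeSector A B (A / B) (lam * (A / B))} =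
        Ico (B / A / lam * x) (B / A * x) := by
      ext y
      simp only [mem_ofPred_eq, mem_preimage, Prod.swap_prod_mk, key, hx.le, true_and]
    rw [this]
    exact Ico_ae_eq_Ioc
  · intro y x hx h
    exact absurd ((key x y).1 h).1 (not_le.2 hx)

/-- The weighted area of the free region in a fundamental sector for the squares of the units,
computed at once for any position of the sector relative to the box. -/
lemma freeMass_eq {A B : ℝ} (hA : 0 < A) (hB : 0 < B) :
    freeMass A B (lam ^ (-2 : ℤ)) (lam ^ 2) = ENNReal.ofReal (lam / (A ^ 2 * B ^ 2)) := by
  have hl := lam_pos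
  have h0 := hl.ne'
  have h1 := one_lt_lam
  have hl2 : 1 < lam ^ 2 := one_lt_pow₀ h1 two_ne_zero
  obtain ⟨k, hk₁, hk₂⟩ := exists_mem_Ico_zpow (show 0 < A / B / lam by positivity) hl2
  rw [← freeMass_lam_zpow (-k)]
  set A' := lam ^ (-k) * A with hA'
  set B' := lam ^ (-(-k)) * B with hB'
  have hA0 : 0 < A' := by positivity
  have hB0 : 0 < B' := by positivity
  have hAB : A' * B' = A * B := by
    rw [hA', hB', neg_neg, _root_.zpow_neg]; field_simp
  have hd : A' / B' / lam = A / B / lam / (lam ^ 2) ^ k := by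
    have : ((lam ^ 2) ^ k : ℝ) = lam ^ k * lam ^ k := by
      rw [← mul_zpow]; congr 1; ring
    rw [hA', hB', neg_neg, _root_.zpow_neg, this]; field_simp
  have hp : (0 : ℝ) < (lam ^ 2) ^ k := by positivity
  set d := A' / B' / lam with hdd
  have hd1 : 1 ≤ d := by rw [hd, one_le_div hp]; exact hk₁
  have hd2 : d ≤ lam ^ 2 := by
    rw [hd, div_le_iff₀ hp]
    rw [zpow_add_one₀ (by positivity)] at hk₂
    linarith
  have hper : freeMass A' B' 1 (lam ^ 2) = ENNReal.ofReal (lam / (2 * (A ^ 2 * B ^ 2))) := by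
    have e : lam ^ 2 * d = lam * (A' / B') := by rw [hdd]; field_simp
    have e' : lam / (2 * (A ^ 2 * B ^ 2)) =
        lam / (4 * (A' ^ 2 * B' ^ 2)) + lam / (4 * (A' ^ 2 * B' ^ 2)) := by
      rw [← mul_pow A' B', hAB]; field_simp; norm_num
    calc freeMass A' B' 1 (lam ^ 2)
        = freeMass A' B' d (lam ^ 2) + freeMass A' B' (lam ^ 2 * 1) (lam ^ 2 * d) := by
          rw [freeMass_lam_sq, add_comm, freeMass_add hd1 hd2]
      _ = freeMass A' B' d (lam * (A' / B')) := by
          rw [mul_one, freeMass_add hd2 (le_mul_of_one_le_right (by positivity) hd1), e]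
      _ = freeMass A' B' d (A' / B') + freeMass A' B' (A' / B') (lam * (A' / B')) := by
          rw [freeMass_add (div_le_self (by positivity) h1.le)
            (le_mul_of_one_le_left (by positivity) h1.le)]
      _ = _ := by
          rw [freeMass_lower hA0 hB0, freeMass_upper hA0 hB0,
            ← ENNReal.ofReal_add (by positivity) (by positivity), e']
  have hz : lam ^ (-2 : ℤ) = (lam ^ 2)⁻¹ := by
    rw [_root_.zpow_neg]; norm_cast
  have hz1 : lam ^ (-2 : ℤ) ≤ 1 := by rw [hz]; exact inv_le_one_of_one_le₀ hl2.le
  rw [← freeMass_add hz1 hl2.le, ← freeMass_lam_sq _ _ (lam ^ (-2 : ℤ)), mul_one, hz,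
    mul_inv_cancel₀ (by positivity), hper, ← ENNReal.ofReal_add (by positivity) (by positivity)]
  congr 1
  field_simp; norm_num

/-- The half-width of the projection of the unit triangle `T₁` rotated by `θ`. -/
def triangleWidth (θ : ℝ) : ℝ := |Real.cos θ| + Real.sin θ

/-- `√2` times the support function of the octagon `𝒲`. -/
def octagonSupport (θ : ℝ) : ℝ :=
  max (lam * |Real.cos θ| + |Real.sin θ|) (|Real.cos θ| + lam * |Real.sin θ|)

lemma exists_rotate_mem_Tset_iff {s θ x : ℝ} (h₀ : 0 ≤ Real.sin θ)
    (h₁ : Real.sin θ ≤ |Real.cos θ|) :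
    (∃ c, (x * Real.cos θ + c * Real.sin θ, -x * Real.sin θ + c * Real.cos θ) ∈ Tset s) ↔
      0 < x * Real.cos θ ∧ |x| < √(s / thetaHat) * triangleWidth θ := by
  set D := √(s / thetaHat)
  have hcs := Real.sin_sq_add_cos_sq θ
  have hc : 0 < |Real.cos θ| := by
    rcases (abs_nonneg (Real.cos θ)).eq_or_lt with h | h
    · have := abs_eq_zero.1 h.symm
      rw [← h] at h₁
      rw [this, le_antisymm h₁ h₀] at hcs
      norm_num at hcs
    · exact h
  obtain ⟨ε, hε, hεc⟩ : ∃ ε : ℝ, ε * ε = 1 ∧ Real.cos θ = ε * |Real.cos θ| := by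
    rcases abs_cases (Real.cos θ) with h | h
    · exact ⟨1, by norm_num, by rw [h.1]; ring⟩
    · exact ⟨-1, by norm_num, by rw [h.1]; ring⟩
  have hεabs : |ε| = 1 := by
    have := abs_mul_abs_self ε
    rw [hε] at this
    nlinarith [abs_nonneg ε]
  set C := |Real.cos θ|
  set S := Real.sin θ
  have hxabs : |x| = |ε * x| := by rw [abs_mul, hεabs, one_mul]
  have hSC : S ^ 2 + C ^ 2 = 1 := by rw [← hcs, hεc]; linear_combination -C ^ 2 * hε
  have hS1 : S ≤ 1 := Real.sin_le_one θ
  have hpos : 0 < x * Real.cos θ ↔ 0 < ε * x := by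
    rw [hεc, show x * (ε * C) = (ε * x) * C by ring, mul_pos_iff_of_pos_right hc]
  rw [hpos]
  constructor
  · rintro ⟨c, hp₁, hp₂, hp₃⟩
    simp only at hp₁ hp₂ hp₃
    set p₁ := x * Real.cos θ + c * S with hp₁'
    set p₂ := -x * S + c * Real.cos θ with hp₂'
    have hx : ε * x = p₁ * C - (ε * p₂) * S := by
      rw [hp₁', hp₂', hεc]
      linear_combination (-(ε * x)) * hSC + c * C * S * hε
    have hq : |ε * p₂| < p₁ := by rwa [abs_mul, hεabs, one_mul]
    obtain ⟨hq₁, hq₂⟩ := abs_lt.1 hq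
    have hx0 : 0 < ε * x := by
      rw [hx]
      have : (ε * p₂) * S ≤ |ε * p₂| * C := by
        calc (ε * p₂) * S ≤ |ε * p₂| * S := by gcongr; exact le_abs_self _
          _ ≤ |ε * p₂| * C := by gcongr
      nlinarith
    refine ⟨hx0, ?_⟩
    rw [hxabs, abs_of_pos hx0, hx, triangleWidth]
    change _ < D * (C + S)
    nlinarith
  · rintro ⟨hx0, hxD⟩
    rw [hxabs, abs_of_pos hx0, triangleWidth] at hxD
    change _ < D * (C + S) at hxD
    have hD : 0 < D := by
      by_contra! h
      nlinarith
    set X := ε * x with hX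
    obtain ⟨κ, hκ0, hκ1, hκ⟩ : ∃ κ : ℝ, 0 ≤ κ ∧ κ < 1 ∧ X / D < C + κ * S := by
      have hg : 0 < C + S - X / D := by
        rw [sub_pos, div_lt_iff₀ hD]; linarith
      refine ⟨1 - min 1 ((C + S - X / D) / 2), ?_, ?_, ?_⟩
      · linarith [min_le_left 1 ((C + S - X / D) / 2)]
      · have : 0 < min 1 ((C + S - X / D) / 2) := lt_min one_pos (by linarith)
        linarith
      · have h1 := min_le_right 1 ((C + S - X / D) / 2)
        have h2 : 0 < min 1 ((C + S - X / D) / 2) := lt_min one_pos (by linarith)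
        nlinarith
    have hCS : 0 < C + κ * S := by positivity
    set p := X / (C + κ * S) with hp
    have hp0 : 0 < p := div_pos hx0 hCS
    have hpX : p * (C + κ * S) = X := div_mul_cancel₀ _ hCS.ne'
    have hxX : x = ε * X := by rw [hX]; linear_combination -x * hε
    refine ⟨p * S - ε * κ * p * Real.cos θ, ?_⟩
    have e₁ : x * Real.cos θ + (p * S - ε * κ * p * Real.cos θ) * S = p := by
      rw [hxX, hεc, ← hpX]
      linear_combination (p * C ^ 2) * hε + p * hSC
    have e₂ : -x * S + (p * S - ε * κ * p * Real.cos θ) * Real.cos θ = -ε * κ * p := by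
      rw [hxX, hεc, ← hpX]
      linear_combination (-(ε * κ * p * C ^ 2)) * hε - ε * κ * p * hSC
    rw [e₁, e₂]
    refine ⟨hp0, ?_, ?_⟩
    · change p < D
      rw [hp, div_lt_iff₀ hCS]
      rw [div_lt_iff₀ hD] at hκ
      linarith
    · simp only
      rw [abs_mul, abs_mul, abs_neg, hεabs, abs_of_nonneg hκ0, abs_of_pos hp0]
      nlinarith

lemma abs_mul_add_mul_le {a b u v : ℝ} : |a * u + b * v| ≤ |a| * |u| + |b| * |v| := by
  rw [← abs_mul, ← abs_mul]; exact abs_add_le _ _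

lemma lam_mul_sqrt_two : lam * √2 = lam + 1 := by
  have := Real.mul_self_sqrt (show (0 : ℝ) ≤ 2 by norm_num)
  unfold lam; linear_combination this

lemma abs_projection_lt_of_mem_Woct {p : ℝ × ℝ} (hp : p ∈ Woct) (θ : ℝ) :
    |p.1 * Real.cos θ - p.2 * Real.sin θ| < octagonSupport θ / √2 := by
  obtain ⟨h₁, h₂, h₃⟩ := hp
  have h2 : 0 < √2 := by positivity
  have hl := lam_mul_sqrt_two
  have hcs : 0 < |Real.cos θ| ∨ 0 < |Real.sin θ| := by
    simp only [abs_pos]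
    by_contra! h
    simpa [h.1, h.2] using Real.sin_sq_add_cos_sq θ
  have hle : |p.1 * Real.cos θ - p.2 * Real.sin θ| ≤
      |p.1| * |Real.cos θ| + |p.2| * |Real.sin θ| := by
    have := abs_mul_add_mul_le (a := p.1) (u := Real.cos θ) (b := p.2) (v := -Real.sin θ)
    rwa [abs_neg, mul_neg, ← sub_eq_add_neg] at this
  refine hle.trans_lt ?_
  rw [lt_div_iff₀ h2]
  rw [lt_div_iff₀ h2] at h₁ h₂
  have h₃' : |p.1| * √2 + |p.2| * √2 < lam + 1 := by
    rw [← hl, ← add_mul]; exact mul_lt_mul_of_pos_right h₃ h2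
  set C := |Real.cos θ|
  set S := |Real.sin θ|
  have hC : 0 ≤ C := abs_nonneg _
  have hS : 0 ≤ S := abs_nonneg _
  rcases le_total S C with h | h
  · refine lt_of_lt_of_le ?_ (le_max_left _ _)
    change (|p.1| * C + |p.2| * S) * √2 < lam * C + S
    have hC0 : 0 < C := hcs.elim id fun h' => h'.trans_le h
    rcases hS.eq_or_lt with h' | h'
    · rw [← h']; nlinarith
    · nlinarith [mul_le_mul_of_nonneg_right h₁.le (sub_nonneg.2 h)]
  · refine lt_of_lt_of_le ?_ (le_max_right _ _)
    change (|p.1| * C + |p.2| * S) * √2 < C + lam * S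
    have hS0 : 0 < S := hcs.elim (fun h' => h'.trans_le h) id
    rcases hC.eq_or_lt with h' | h'
    · rw [← h']; nlinarith
    · nlinarith [mul_le_mul_of_nonneg_right h₂.le (sub_nonneg.2 h)]

lemma half_lam_add_one_le_octagonSupport (θ : ℝ) : (lam + 1) / 2 ≤ octagonSupport θ := by
  have h₁ := le_max_left (lam * |Real.cos θ| + |Real.sin θ|) (|Real.cos θ| + lam * |Real.sin θ|)
  have h₂ := le_max_right (lam * |Real.cos θ| + |Real.sin θ|) (|Real.cos θ| + lam * |Real.sin θ|)
  have h₃ := Real.sin_sq_add_cos_sq θ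
  have hl := lam_pos
  rw [← sq_abs (Real.sin θ), ← sq_abs (Real.cos θ)] at h₃
  have h₄ : 1 ≤ |Real.cos θ| + |Real.sin θ| := by
    nlinarith [abs_nonneg (Real.sin θ), abs_nonneg (Real.cos θ)]
  unfold octagonSupport
  nlinarith

lemma octagonSupport_pos (θ : ℝ) : 0 < octagonSupport θ :=
  lt_of_lt_of_le (by linarith [lam_pos]) (half_lam_add_one_le_octagonSupport θ)

lemma smul_mem_Woct {P Q τ : ℝ} (hτ : |τ| < 1)
    (h : (|P| = lam ∧ |Q| = 1) ∨ (|P| = 1 ∧ |Q| = lam)) : (τ * P / √2, τ * Q / √2) ∈ Woct := by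
  have h2 : 0 < √2 := by positivity
  have hl := lam_pos
  have h1 := one_lt_lam
  have hl2 := lam_mul_sqrt_two
  have h0 := abs_nonneg τ
  simp only [Woct, mem_ofPred_eq, abs_div, abs_mul, abs_of_pos h2]
  rw [← add_div, div_lt_div_iff_of_pos_right h2, div_lt_div_iff_of_pos_right h2, div_lt_iff₀ h2, hl2]
  rcases h with ⟨h, h'⟩ | ⟨h, h'⟩ <;> rw [h, h'] <;> refine ⟨?_, ?_, ?_⟩ <;> nlinarith

lemma exists_rotate_mem_Woct_iff {θ x : ℝ} :
    (∃ c, (x * Real.cos θ + c * Real.sin θ, -x * Real.sin θ + c * Real.cos θ) ∈ Woct) ↔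
      |x| < octagonSupport θ / √2 := by
  have hcs := Real.sin_sq_add_cos_sq θ
  constructor
  · rintro ⟨c, hc⟩
    have := abs_projection_lt_of_mem_Woct hc θ
    convert this using 2
    linear_combination -x * hcs
  · intro hx
    have h2 : 0 < √2 := by positivity
    have hM := octagonSupport_pos θ
    obtain ⟨P, Q, hPQ, hv⟩ : ∃ P Q : ℝ, ((|P| = lam ∧ |Q| = 1) ∨ (|P| = 1 ∧ |Q| = lam)) ∧
        P * Real.cos θ - Q * Real.sin θ = octagonSupport θ := by
      have key : ∀ z : ℝ, ∃ ε : ℝ, |ε| = 1 ∧ ε * z = |z| := by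
        intro z
        rcases abs_cases z with h | h
        · exact ⟨1, by simp, by rw [h.1, one_mul]⟩
        · exact ⟨-1, by simp, by rw [h.1, neg_one_mul]⟩
      obtain ⟨ε, hε, hε'⟩ := key (Real.cos θ)
      obtain ⟨δ, hδ, hδ'⟩ := key (Real.sin θ)
      have hl : |lam| = lam := abs_of_pos lam_pos
      rcases max_cases (lam * |Real.cos θ| + |Real.sin θ|) (|Real.cos θ| + lam * |Real.sin θ|)
        with h | h
      · refine ⟨lam * ε, -δ, .inl ⟨by rw [abs_mul, hε, hl, mul_one], by rw [abs_neg, hδ]⟩, ?_⟩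
        rw [octagonSupport, h.1, ← hε', ← hδ']; ring
      · refine ⟨ε, -(lam * δ), .inr ⟨hε, by rw [abs_neg, abs_mul, hδ, hl, mul_one]⟩, ?_⟩
        rw [octagonSupport, h.1, ← hε', ← hδ']; ring
    set τ := x * √2 / octagonSupport θ with hτ
    have hτ1 : |τ| < 1 := by
      rw [hτ, abs_div, abs_mul, abs_of_pos hM, abs_of_pos h2, div_lt_one hM]
      rwa [lt_div_iff₀ h2] at hx
    have hx' : x = τ * (P * Real.cos θ - Q * Real.sin θ) / √2 := by
      rw [hτ, hv]; field_simp
    refine ⟨(τ * P / √2) * Real.sin θ + (τ * Q / √2) * Real.cos θ, ?_⟩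
    convert smul_mem_Woct hτ1 hPQ using 2
    · rw [hx']; linear_combination (τ * P / √2) * hcs
    · rw [hx']; linear_combination (τ * Q / √2) * hcs

lemma vecMul_bd_kmat (a b c d θ₁ θ₂ : ℝ) :
    Matrix.vecMul ![a, c, b, d] (bd (kmat θ₁) (kmat θ₂)) =
      ![a * Real.cos θ₁ + c * Real.sin θ₁, -a * Real.sin θ₁ + c * Real.cos θ₁,
        b * Real.cos θ₂ + d * Real.sin θ₂, -b * Real.sin θ₂ + d * Real.cos θ₂] := by
  ext i
  fin_cases i <;> simp [Matrix.vecMul, dotProduct, Fin.sum_univ_four, bd, kmat]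

lemma Ltilde_inter_calTs_nonempty_iff (s y₁ y₂ θ₁ θ₂ : ℝ) :
    (Ltilde y₁ y₂ θ₁ θ₂ ∩ calTs s).Nonempty ↔ ∃ m n : ℤ,
      (∃ c, ((lam ^ (2 * rr s) * ((m + n * √2) * y₁)) * Real.cos θ₁ + c * Real.sin θ₁,
        -(lam ^ (2 * rr s) * ((m + n * √2) * y₁)) * Real.sin θ₁ + c * Real.cos θ₁) ∈ Tset s) ∧
      ∃ c, ((lam ^ (-(2 * rr s)) * ((m - n * √2) * y₂)) * Real.cos θ₂ + c * Real.sin θ₂,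
        -(lam ^ (-(2 * rr s)) * ((m - n * √2) * y₂)) * Real.sin θ₂ + c * Real.cos θ₂) ∈ Woct := by
  have hp : lam ^ (2 * rr s) ≠ 0 := (zpow_pos lam_pos _).ne'
  have hp' : lam ^ (-(2 * rr s)) ≠ 0 := (zpow_pos lam_pos _).ne'
  have scale : ∀ (U : Set (ℝ × ℝ)) (l a c θ : ℝ),
      (l * (a * Real.cos θ + c * Real.sin θ), l * (-a * Real.sin θ + c * Real.cos θ)) ∈ U ↔
      ((l * a) * Real.cos θ + (l * c) * Real.sin θ,
        -(l * a) * Real.sin θ + (l * c) * Real.cos θ) ∈ U := by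
    intro U l a c θ
    have e : (l * (a * Real.cos θ + c * Real.sin θ), l * (-a * Real.sin θ + c * Real.cos θ)) =
        ((l * a) * Real.cos θ + (l * c) * Real.sin θ,
        -(l * a) * Real.sin θ + (l * c) * Real.cos θ) := by
      ext <;> ring
    rw [e]
  constructor
  · rintro ⟨v, ⟨m, n, c₁, c₂, rfl⟩, h₁, h₂⟩
    rw [vecMul_bd_kmat] at h₁ h₂
    exact ⟨m, n, ⟨_, (scale _ _ _ _ _).1 h₁⟩, ⟨_, (scale _ _ _ _ _).1 h₂⟩⟩
  · rintro ⟨m, n, ⟨c₁, h₁⟩, ⟨c₂, h₂⟩⟩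
    refine ⟨_, ⟨m, n, (lam ^ (2 * rr s))⁻¹ * c₁, (lam ^ (-(2 * rr s)))⁻¹ * c₂, rfl⟩, ?_⟩
    rw [vecMul_bd_kmat]
    refine ⟨(scale _ _ _ _ _).2 ?_, (scale _ _ _ _ _).2 ?_⟩
    · rwa [mul_inv_cancel_left₀ hp]
    · rwa [mul_inv_cancel_left₀ hp']

lemma eq_zero_of_add_mul_sqrt_two_eq_zero {m n : ℤ} (h : (m : ℝ) + n * √2 = 0) :
    m = 0 ∧ n = 0 := by
  have hn : n = 0 := by
    by_contra hn
    have hn' : (n : ℝ) ≠ 0 := by exact_mod_cast hn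
    refine irrational_sqrt_two ⟨-m / n, ?_⟩
    push_cast
    rw [div_eq_iff hn']
    linarith
  subst hn
  simpa using h

lemma thetaHat_pos : 0 < thetaHat := by
  unfold thetaHat; positivity

lemma Ltilde_inter_calTs_eq_empty_iff {s y₁ y₂ θ₁ θ₂ : ℝ} (hy₁ : 0 < y₁) (hy₂ : 0 < y₂)
    (h₀ : 0 ≤ Real.sin θ₁) (h₁ : Real.sin θ₁ ≤ |Real.cos θ₁|) :
    Ltilde y₁ y₂ θ₁ θ₂ ∩ calTs s = ∅ ↔
      BoxFree (lam ^ (-(2 * rr s)) * (√(s / thetaHat) * triangleWidth θ₁) / y₁)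
        (lam ^ (2 * rr s) * (octagonSupport θ₂ / √2) / y₂) := by
  rw [← not_nonempty_iff_eq_empty, Ltilde_inter_calTs_nonempty_iff]
  simp only [exists_rotate_mem_Tset_iff h₀ h₁, exists_rotate_mem_Woct_iff, BoxFree]
  have hp : 0 < lam ^ (2 * rr s) := zpow_pos lam_pos _
  have hcos : Real.cos θ₁ ≠ 0 := by
    intro h
    have := Real.sin_sq_add_cos_sq θ₁
    rw [h, abs_zero] at h₁
    rw [h, le_antisymm h₁ h₀] at this
    norm_num at this
  have e₁ : ∀ z D : ℝ, |lam ^ (2 * rr s) * (z * y₁)| < D ↔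
      |z| < lam ^ (-(2 * rr s)) * D / y₁ := by
    intro z D
    rw [abs_mul, abs_mul, abs_of_pos hy₁, abs_of_pos hp, lt_div_iff₀ hy₁, _root_.zpow_neg,
      inv_mul_eq_div, lt_div_iff₀ hp, mul_comm]
  have e₂ : ∀ z D : ℝ, |lam ^ (-(2 * rr s)) * (z * y₂)| < D ↔
      |z| < lam ^ (2 * rr s) * D / y₂ := by
    intro z D
    rw [abs_mul, abs_mul, abs_of_pos hy₂, _root_.zpow_neg, abs_of_pos (inv_pos.2 hp),
      lt_div_iff₀ hy₂, inv_mul_lt_iff₀ hp]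
  simp only [e₁, e₂]
  constructor
  · intro h m n ha hb
    by_contra hmn
    have hz : (m : ℝ) + n * √2 ≠ 0 := fun hz => hmn (eq_zero_of_add_mul_sqrt_two_eq_zero hz)
    have hne : (lam ^ (2 * rr s) * ((m + n * √2) * y₁)) * Real.cos θ₁ ≠ 0 := by positivity
    rcases hne.lt_or_gt with hlt | hgt
    · refine h ⟨-m, -n, ⟨?_, ?_⟩, ?_⟩
      · push_cast; linarith
      · rw [← abs_neg]; convert ha using 2; push_cast; ring
      · rw [← abs_neg]; convert hb using 2; push_cast; ring
    · exact h ⟨m, n, ⟨hgt, ha⟩, hb⟩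
  · rintro h ⟨m, n, ⟨hpos, ha⟩, hb⟩
    obtain ⟨rfl, rfl⟩ := h m n ha hb
    simp at hpos

lemma Ltilde_inter_calTs_nonempty {s θ₁ : ℝ} (y₁ y₂ θ₂ : ℝ) (hs : 0 < s)
    (h : |Real.cos θ₁| < Real.sin θ₁) : (Ltilde y₁ y₂ θ₁ θ₂ ∩ calTs s).Nonempty := by
  have hD : 0 < √(s / thetaHat) := Real.sqrt_pos.2 (div_pos hs thetaHat_pos)
  have hS : 0 < Real.sin θ₁ := (abs_nonneg _).trans_lt h
  have hS1 := Real.sin_le_one θ₁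
  rw [Ltilde_inter_calTs_nonempty_iff]
  refine ⟨0, 0, ⟨√(s / thetaHat) / 2, ?_⟩, ?_⟩
  · simp only [Tset, mem_ofPred_eq, Int.cast_zero, zero_mul, add_zero, mul_zero, neg_zero, zero_add]
    refine ⟨by positivity, by nlinarith, ?_⟩
    rw [abs_mul, abs_of_pos (by positivity : 0 < √(s / thetaHat) / 2)]
    gcongr
  · rw [exists_rotate_mem_Woct_iff]
    have := octagonSupport_pos θ₂
    simp only [Int.cast_zero, zero_mul, sub_zero, mul_zero, abs_zero]
    positivity

lemma integral_inv_sq_cos_add_sin {p q a b : ℝ} {f : ℝ → ℝ} (hab : a ≤ b) (hp : p ≠ 0)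
    (hpos : ∀ θ ∈ Icc a b, 0 < p * Real.cos θ + q * Real.sin θ)
    (hf : ∀ θ ∈ Ioo a b, f θ = ((p * Real.cos θ + q * Real.sin θ) ^ 2)⁻¹) :
    IntervalIntegrable f volume a b ∧
      ∫ θ in a..b, f θ = Real.sin b / (p * (p * Real.cos b + q * Real.sin b)) -
        Real.sin a / (p * (p * Real.cos a + q * Real.sin a)) := by
  have hi : IntervalIntegrable (fun θ => ((p * Real.cos θ + q * Real.sin θ) ^ 2)⁻¹)
      volume a b := by
    apply ContinuousOn.intervalIntegrable
    rw [uIcc_of_le hab]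
    exact ContinuousOn.inv₀ (by fun_prop) fun x hx => pow_ne_zero 2 (hpos x hx).ne'
  have hd : ∀ θ ∈ uIcc a b,
      HasDerivAt (fun θ => Real.sin θ / (p * (p * Real.cos θ + q * Real.sin θ)))
        ((p * Real.cos θ + q * Real.sin θ) ^ 2)⁻¹ θ := by
    intro θ hθ
    rw [uIcc_of_le hab] at hθ
    have h0 := (hpos θ hθ).ne'
    have := (Real.hasDerivAt_sin θ).div ((((Real.hasDerivAt_cos θ).const_mul p).add
      ((Real.hasDerivAt_sin θ).const_mul q)).const_mul p) (mul_ne_zero hp h0)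
    refine this.congr_deriv ?_
    have hcs := Real.sin_sq_add_cos_sq θ
    change (Real.cos θ * (p * (p * Real.cos θ + q * Real.sin θ)) -
      Real.sin θ * (p * (p * -Real.sin θ + q * Real.cos θ))) /
        (p * (p * Real.cos θ + q * Real.sin θ)) ^ 2 = _
    rw [show Real.cos θ * (p * (p * Real.cos θ + q * Real.sin θ)) -
      Real.sin θ * (p * (p * -Real.sin θ + q * Real.cos θ)) = p ^ 2 by
        linear_combination p ^ 2 * hcs]
    field_simp
  refine ⟨hi.congr_uIoo ?_, ?_⟩
  · rw [uIoo_of_le hab]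
    exact fun θ hθ => (hf θ hθ).symm
  · rw [intervalIntegral.integral_congr_Ioo_of_le hab hf,
      intervalIntegral.integral_eq_sub_of_hasDerivAt hd hi]

lemma sin_le_cos_of_mem {θ : ℝ} (h : θ ∈ Icc 0 (Real.pi / 4)) :
    0 ≤ Real.sin θ ∧ Real.sin θ ≤ Real.cos θ ∧ 0 < Real.cos θ := by
  have hpi := Real.pi_pos
  have h₁ : Real.sin θ ≤ Real.sin (Real.pi / 4) :=
    Real.sin_le_sin_of_le_of_le_pi_div_two (by linarith [h.1]) (by linarith) h.2
  have h₂ : Real.cos (Real.pi / 4) ≤ Real.cos θ :=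
    Real.cos_le_cos_of_nonneg_of_le_pi h.1 (by linarith) h.2
  have h₃ : 0 < Real.cos (Real.pi / 4) := by rw [Real.cos_pi_div_four]; positivity
  rw [Real.sin_pi_div_four, ← Real.cos_pi_div_four] at h₁
  exact ⟨Real.sin_nonneg_of_nonneg_of_le_pi h.1 (by linarith [h.2]), h₁.trans h₂,
    h₃.trans_le h₂⟩

lemma cos_le_sin_of_mem {θ : ℝ} (h : θ ∈ Icc (Real.pi / 4) (Real.pi / 2)) :
    0 ≤ Real.cos θ ∧ Real.cos θ ≤ Real.sin θ ∧ 0 < Real.sin θ := by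
  have := sin_le_cos_of_mem (θ := Real.pi / 2 - θ) ⟨by linarith [h.2], by linarith [h.1]⟩
  rwa [Real.sin_pi_div_two_sub, Real.cos_pi_div_two_sub] at this

lemma neg_cos_le_sin_of_mem {θ : ℝ} (h : θ ∈ Icc (Real.pi / 2) (3 * Real.pi / 4)) :
    0 ≤ -Real.cos θ ∧ -Real.cos θ ≤ Real.sin θ ∧ 0 < Real.sin θ := by
  have := cos_le_sin_of_mem (θ := Real.pi - θ) ⟨by linarith [h.2], by linarith [h.1]⟩
  rwa [Real.sin_pi_sub, Real.cos_pi_sub] at this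

lemma sin_le_neg_cos_of_mem {θ : ℝ} (h : θ ∈ Icc (3 * Real.pi / 4) Real.pi) :
    0 ≤ Real.sin θ ∧ Real.sin θ ≤ -Real.cos θ ∧ 0 < -Real.cos θ := by
  have := sin_le_cos_of_mem (θ := Real.pi - θ) ⟨by linarith [h.2], by linarith [h.1]⟩
  rwa [Real.sin_pi_sub, Real.cos_pi_sub] at this

lemma abs_cos_lt_sin_of_mem {θ : ℝ} (h : θ ∈ Ioo (Real.pi / 4) (3 * Real.pi / 4)) :
    |Real.cos θ| < Real.sin θ := by
  have hpi := Real.pi_pos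
  have h₁ : Real.cos θ < Real.cos (Real.pi / 4) :=
    Real.cos_lt_cos_of_nonneg_of_le_pi (by linarith) (by linarith [h.2]) h.1
  have h₂ : Real.cos (Real.pi - θ) < Real.cos (Real.pi / 4) :=
    Real.cos_lt_cos_of_nonneg_of_le_pi (by linarith) (by linarith [h.1]) (by linarith [h.2])
  rw [Real.cos_pi_sub] at h₂
  have h₃ : |Real.cos θ| < Real.cos (Real.pi / 4) := abs_lt.2 ⟨by linarith, h₁⟩
  have h₄ := Real.sin_sq_add_cos_sq θ
  have h₅ : Real.cos (Real.pi / 4) ^ 2 = 1 / 2 := by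
    rw [Real.cos_pi_div_four, div_pow, Real.sq_sqrt (by norm_num)]; norm_num
  have h₆ : 0 ≤ Real.sin θ := Real.sin_nonneg_of_nonneg_of_le_pi (by linarith [h.1])
    (by linarith [h.2])
  refine abs_lt_of_sq_lt_sq ?_ h₆
  have : Real.cos θ ^ 2 < Real.cos (Real.pi / 4) ^ 2 := by
    rw [← sq_abs (Real.cos θ)]
    exact pow_lt_pow_left₀ h₃ (abs_nonneg _) two_ne_zero
  linarith

lemma sin_three_pi_div_four : Real.sin (3 * Real.pi / 4) = √2 / 2 := by
  rw [show 3 * Real.pi / 4 = Real.pi - Real.pi / 4 by ring, Real.sin_pi_sub, Real.sin_pi_div_four]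

lemma cos_three_pi_div_four : Real.cos (3 * Real.pi / 4) = -(√2 / 2) := by
  rw [show 3 * Real.pi / 4 = Real.pi - Real.pi / 4 by ring, Real.cos_pi_sub, Real.cos_pi_div_four]

lemma integral_octagonSupport :
    ∫ θ in Ico 0 Real.pi, (octagonSupport θ ^ 2)⁻¹ = 4 / (lam * (lam + 1)) := by
  have hpi := Real.pi_pos
  have hl := lam_pos
  have h1 := one_lt_lam
  have h2 : 0 < √2 := by positivity
  have large : ∀ θ, |Real.sin θ| ≤ |Real.cos θ| →
      octagonSupport θ = lam * |Real.cos θ| + |Real.sin θ| := fun θ h =>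
    max_eq_left (by nlinarith)
  have small : ∀ θ, |Real.cos θ| ≤ |Real.sin θ| →
      octagonSupport θ = |Real.cos θ| + lam * |Real.sin θ| := fun θ h =>
    max_eq_right (by nlinarith)
  obtain ⟨i₁, e₁⟩ := integral_inv_sq_cos_add_sin (p := lam) (q := 1) (a := 0) (b := Real.pi / 4)
    (f := fun θ => (octagonSupport θ ^ 2)⁻¹) (by linarith) hl.ne'
    (fun θ h => by
      obtain ⟨a, b, c⟩ := sin_le_cos_of_mem h
      nlinarith)
    (fun θ h => by
      obtain ⟨a, b, c⟩ := sin_le_cos_of_mem (Ioo_subset_Icc_self h)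
      rw [large θ (by rw [abs_of_nonneg a, abs_of_pos c]; exact b), abs_of_nonneg a,
        abs_of_pos c, one_mul])
  obtain ⟨i₂, e₂⟩ := integral_inv_sq_cos_add_sin (p := 1) (q := lam) (a := Real.pi / 4) (b := Real.pi / 2)
    (f := fun θ => (octagonSupport θ ^ 2)⁻¹) (by linarith) one_ne_zero
    (fun θ h => by
      obtain ⟨a, b, c⟩ := cos_le_sin_of_mem h
      nlinarith)
    (fun θ h => by
      obtain ⟨a, b, c⟩ := cos_le_sin_of_mem (Ioo_subset_Icc_self h)
      rw [small θ (by rw [abs_of_nonneg a, abs_of_pos c]; exact b), abs_of_nonneg a,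
        abs_of_pos c, one_mul])
  obtain ⟨i₃, e₃⟩ := integral_inv_sq_cos_add_sin (p := -1) (q := lam) (a := Real.pi / 2)
    (b := 3 * Real.pi / 4) (f := fun θ => (octagonSupport θ ^ 2)⁻¹) (by linarith) (by norm_num)
    (fun θ h => by
      obtain ⟨a, b, c⟩ := neg_cos_le_sin_of_mem h
      nlinarith)
    (fun θ h => by
      obtain ⟨a, b, c⟩ := neg_cos_le_sin_of_mem (Ioo_subset_Icc_self h)
      have hc : |Real.cos θ| = -Real.cos θ := abs_of_nonpos (by linarith)
      rw [small θ (by rw [hc, abs_of_pos c]; exact b), hc, abs_of_pos c, neg_one_mul])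
  obtain ⟨i₄, e₄⟩ := integral_inv_sq_cos_add_sin (p := -lam) (q := 1) (a := 3 * Real.pi / 4)
    (b := Real.pi) (f := fun θ => (octagonSupport θ ^ 2)⁻¹) (by linarith) (by linarith)
    (fun θ h => by
      obtain ⟨a, b, c⟩ := sin_le_neg_cos_of_mem h
      nlinarith)
    (fun θ h => by
      obtain ⟨a, b, c⟩ := sin_le_neg_cos_of_mem (Ioo_subset_Icc_self h)
      have hc : |Real.cos θ| = -Real.cos θ := abs_of_neg (by linarith)
      rw [large θ (by rw [hc, abs_of_nonneg a]; exact b), hc, abs_of_nonneg a, one_mul,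
        mul_neg, neg_mul])
  rw [integral_Ico_eq_integral_Ioc, ← intervalIntegral.integral_of_le hpi.le,
    ← intervalIntegral.integral_add_adjacent_intervals (i₁.trans (i₂.trans i₃)) i₄,
    ← intervalIntegral.integral_add_adjacent_intervals i₁ (i₂.trans i₃),
    ← intervalIntegral.integral_add_adjacent_intervals i₂ i₃, e₁, e₂, e₃, e₄]
  simp only [Real.sin_zero, Real.cos_zero, Real.sin_pi_div_four, Real.cos_pi_div_four,
    Real.sin_pi_div_two, Real.cos_pi_div_two, sin_three_pi_div_four, cos_three_pi_div_four,
    Real.sin_pi, Real.cos_pi]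
  have f₁ : √2 / 2 / (lam * (lam * (√2 / 2) + 1 * (√2 / 2))) = 1 / (lam * (lam + 1)) := by
    field_simp
  have f₂ : √2 / 2 / (1 * (1 * (√2 / 2) + lam * (√2 / 2))) = 1 / (lam + 1) := by
    field_simp; ring
  have f₃ : √2 / 2 / (-1 * (-1 * (-(√2 / 2)) + lam * (√2 / 2))) = -(1 / (lam + 1)) := by
    rw [show -1 * (-1 * (-(√2 / 2)) + lam * (√2 / 2)) =
      -(1 * (1 * (√2 / 2) + lam * (√2 / 2))) by ring, div_neg, f₂]
  have f₄ : √2 / 2 / (-lam * (-lam * (-(√2 / 2)) + 1 * (√2 / 2))) =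
      -(1 / (lam * (lam + 1))) := by
    rw [show -lam * (-lam * (-(√2 / 2)) + 1 * (√2 / 2)) =
      -(lam * (lam * (√2 / 2) + 1 * (√2 / 2))) by ring, div_neg, f₁]
  rw [f₁, f₂, f₃, f₄]
  field_simp
  ring

lemma integral_triangleWidth :
    ∫ θ in Ico 0 Real.pi, (if Real.sin θ ≤ |Real.cos θ| then (triangleWidth θ ^ 2)⁻¹ else 0) = 1 := by
  have hpi := Real.pi_pos
  have h2 : 0 < √2 := by positivity
  set f : ℝ → ℝ := fun θ => if Real.sin θ ≤ |Real.cos θ| then (triangleWidth θ ^ 2)⁻¹ else 0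
    with hf
  obtain ⟨i₁, e₁⟩ := integral_inv_sq_cos_add_sin (p := 1) (q := 1) (a := 0) (b := Real.pi / 4)
    (f := f) (by linarith) one_ne_zero
    (fun θ h => by
      obtain ⟨a, b, c⟩ := sin_le_cos_of_mem h
      linarith)
    (fun θ h => by
      obtain ⟨a, b, c⟩ := sin_le_cos_of_mem (Ioo_subset_Icc_self h)
      simp only [hf, triangleWidth]
      rw [abs_of_pos c, if_pos b, one_mul, one_mul])
  have z : EqOn (fun _ => (0 : ℝ)) f (Ioo (Real.pi / 4) (3 * Real.pi / 4)) := fun θ h =>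
    (if_neg (not_le.2 (abs_cos_lt_sin_of_mem h))).symm
  have i₂ : IntervalIntegrable f volume (Real.pi / 4) (3 * Real.pi / 4) := by
    refine (_root_.intervalIntegrable_const (c := (0 : ℝ))).congr_uIoo ?_
    rwa [uIoo_of_le (by linarith)]
  have e₂ : ∫ θ in (Real.pi / 4)..(3 * Real.pi / 4), f θ = 0 := by
    rw [← intervalIntegral.integral_congr_Ioo_of_le (by linarith) z]; simp
  obtain ⟨i₃, e₃⟩ := integral_inv_sq_cos_add_sin (p := -1) (q := 1) (a := 3 * Real.pi / 4) (b := Real.pi)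
    (f := f) (by linarith) (by norm_num)
    (fun θ h => by
      obtain ⟨a, b, c⟩ := sin_le_neg_cos_of_mem h
      linarith)
    (fun θ h => by
      obtain ⟨a, b, c⟩ := sin_le_neg_cos_of_mem (Ioo_subset_Icc_self h)
      have hc : |Real.cos θ| = -Real.cos θ := abs_of_neg (by linarith)
      simp only [hf, triangleWidth]
      rw [hc, if_pos b, one_mul, neg_one_mul])
  rw [integral_Ico_eq_integral_Ioc, ← intervalIntegral.integral_of_le hpi.le,
    ← intervalIntegral.integral_add_adjacent_intervals (i₁.trans i₂) i₃,
    ← intervalIntegral.integral_add_adjacent_intervals i₁ i₂, e₁, e₂, e₃]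
  simp only [Real.sin_zero, Real.cos_zero, Real.sin_pi_div_four, Real.cos_pi_div_four,
    sin_three_pi_div_four, cos_three_pi_div_four, Real.sin_pi, Real.cos_pi]
  field_simp
  norm_num

lemma measureReal_Fdom : volume.real Fdom = 2 * √2 := by
  set f := Matrix.toLin (Module.Basis.finTwoProd ℝ) (Module.Basis.finTwoProd ℝ)
    !![1, √2; 1, -√2] with hf
  have hF : Fdom = (fun p => ((1, 2) : ℝ × ℝ) + p) '' (f '' (Ico 0 1 ×ˢ Ico 0 1)) := by
    ext p
    constructor
    · rintro ⟨r₁, h₁, r₂, h₂, rfl⟩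
      refine ⟨_, ⟨(r₁, r₂), ⟨h₁, h₂⟩, rfl⟩, ?_⟩
      rw [hf, Matrix.toLin_finTwoProd_apply]
      ext <;> simp <;> ring
    · rintro ⟨_, ⟨⟨r₁, r₂⟩, ⟨h₁, h₂⟩, rfl⟩, rfl⟩
      refine ⟨r₁, h₁, r₂, h₂, ?_⟩
      rw [hf, Matrix.toLin_finTwoProd_apply]
      ext <;> simp <;> ring
  have hdet : LinearMap.det f = -(2 * √2) := by
    rw [hf, LinearMap.det_toLin, Matrix.det_fin_two_of]; ring
  have hpos : 0 ≤ 2 * √2 := by positivity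
  rw [measureReal_def, hF, image_add_left, measure_preimage_add,
    Measure.addHaar_image_linearMap, hdet, abs_neg, abs_of_nonneg hpos, Measure.volume_eq_prod,
    Measure.prod_prod]
  simp

lemma ae_ne_mul_snd (v : ℝ) : ∀ᵐ y : ℝ × ℝ, y.1 ≠ v * y.2 := by
  have h := Measure.addHaar_submodule (volume : Measure (ℝ × ℝ))
    (LinearMap.ker (LinearMap.fst ℝ ℝ ℝ - v • LinearMap.snd ℝ ℝ ℝ)) (by
      intro h
      have : ((1, 0) : ℝ × ℝ) ∈ (⊤ : Submodule ℝ (ℝ × ℝ)) := trivial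
      rw [← h] at this
      simp at this)
  rw [ae_iff]
  convert h using 2
  ext y
  simp [sub_eq_zero]

lemma setIntegral_Yt_boxFree {t A B : ℝ} (hA : 0 < A) (hB : 0 < B)
    (hAB : t * lam ≤ A * B) :
    ∫ y in Yt t, (y.1 ^ 3 * y.2 ^ 3)⁻¹ * ind (BoxFree (A / y.1) (B / y.2)) =
      lam / (A ^ 2 * B ^ 2) := by
  have hl := lam_pos
  have hlz : (0 : ℝ) < lam ^ (-2 : ℤ) := zpow_pos hl _
  have hfree : MeasurableSet {y : ℝ × ℝ | BoxFree (A / y.1) (B / y.2)} :=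
    measurableSet_boxFree.preimage (f := fun y : ℝ × ℝ => (A / y.1, B / y.2)) (by fun_prop)
  have e₁ : (fun y : ℝ × ℝ => (y.1 ^ 3 * y.2 ^ 3)⁻¹ * ind (BoxFree (A / y.1) (B / y.2))) =
      {y : ℝ × ℝ | BoxFree (A / y.1) (B / y.2)}.indicator fun y => (y.1 ^ 3 * y.2 ^ 3)⁻¹ := by
    funext y
    by_cases h : BoxFree (A / y.1) (B / y.2) <;> simp [ind, h]
  have e₂ : (Yt t ∩ {y : ℝ × ℝ | BoxFree (A / y.1) (B / y.2)} : Set (ℝ × ℝ)) =ᵐ[volume]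
      freeSector A B (lam ^ (-2 : ℤ)) (lam ^ 2) := by
    refine Filter.eventuallyEq_set.2 ?_
    filter_upwards [ae_ne_mul_snd (lam ^ 2)] with y hy
    constructor
    · rintro ⟨⟨a, b, c, d, e⟩, f⟩
      exact ⟨b, (lt_div_iff₀ b).1 d, ((div_lt_iff₀ b).1 e).le, f⟩
    · rintro ⟨b, d, e, f⟩
      have a : 0 < y.1 := (mul_pos hlz b).trans d
      refine ⟨⟨a, b, ?_, (lt_div_iff₀ b).2 d, (div_lt_iff₀ b).2 (lt_of_le_of_ne e hy)⟩, f⟩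
      have h := f.mul_le_lam (div_pos hB b)
      rw [div_mul_div_comm, div_le_iff₀ (mul_pos a b)] at h
      nlinarith
  rw [e₁, setIntegral_indicator hfree, setIntegral_congr_set e₂,
    integral_eq_lintegral_of_nonneg_ae]
  · change (freeMass A B (lam ^ (-2 : ℤ)) (lam ^ 2)).toReal = _
    rw [freeMass_eq hA hB, ENNReal.toReal_ofReal (by positivity)]
  · refine (ae_restrict_iff' (measurableSet_freeSector ..)).2 (.of_forall fun y hy => ?_)
    have h₂ : 0 < y.2 := hy.1
    have h₁ : 0 < y.1 := (mul_pos hlz h₂).trans hy.2.1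
    simp only [Pi.zero_apply]
    positivity
  · exact Measurable.aestronglyMeasurable (by fun_prop)

lemma one_le_triangleWidth {θ : ℝ} (h : 0 ≤ Real.sin θ) : 1 ≤ triangleWidth θ := by
  have h₃ := Real.sin_sq_add_cos_sq θ
  rw [← sq_abs (Real.cos θ)] at h₃
  unfold triangleWidth
  nlinarith [abs_nonneg (Real.cos θ)]

/-- The integral over the noncompact directions, for fixed angles. -/
lemma setIntegral_Yt_Fdom {t s θ₁ θ₂ : ℝ} (ht : 0 < t) (hs : 4 * t ^ 2 * thetaHat ≤ s)
    (hθ₁ : θ₁ ∈ Ico 0 Real.pi) :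
    ∫ y in Yt t, ∫ _x in Fdom,
        (y.1 ^ 3 * y.2 ^ 3)⁻¹ * ind (Ltilde y.1 y.2 θ₁ θ₂ ∩ calTs s = ∅) =
      (4 * √2 * lam * thetaHat / s) *
        ((if Real.sin θ₁ ≤ |Real.cos θ₁| then (triangleWidth θ₁ ^ 2)⁻¹ else 0) *
          (octagonSupport θ₂ ^ 2)⁻¹) := by
  have hl := lam_pos
  have hth := thetaHat_pos
  have h2 : 0 < √2 := by positivity
  have hs0 : 0 < s := lt_of_lt_of_le (by positivity) hs
  have hsin : 0 ≤ Real.sin θ₁ := Real.sin_nonneg_of_nonneg_of_le_pi hθ₁.1 hθ₁.2.le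
  simp only [setIntegral_const, measureReal_Fdom, smul_eq_mul]
  rw [integral_const_mul]
  split_ifs with h
  · have hw : 0 < triangleWidth θ₁ := one_pos.trans_le (one_le_triangleWidth hsin)
    have ho := octagonSupport_pos θ₂
    have hp : (0 : ℝ) < lam ^ (2 * rr s) := zpow_pos hl _
    have hD : 2 * t ≤ √(s / thetaHat) := by
      apply Real.le_sqrt_of_sq_le
      rw [le_div_iff₀ hth]
      linarith
    have hD0 : 0 < √(s / thetaHat) := by linarith
    set A := lam ^ (-(2 * rr s)) * (√(s / thetaHat) * triangleWidth θ₁) with hA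
    set B := lam ^ (2 * rr s) * (octagonSupport θ₂ / √2) with hB
    have hA0 : 0 < A := mul_pos (zpow_pos hl _) (by positivity)
    have hB0 : 0 < B := by positivity
    have hAB : A * B = √(s / thetaHat) * triangleWidth θ₁ * (octagonSupport θ₂ / √2) := by
      rw [hA, hB, _root_.zpow_neg]; field_simp
    have hYt : MeasurableSet (Yt t) := by
      refine .inter (measurableSet_lt measurable_const measurable_fst) (.inter
        (measurableSet_lt measurable_const measurable_snd) (.inter ?_ (.inter ?_ ?_)))
      · exact measurableSet_le measurable_const (measurable_fst.mul measurable_snd)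
      · exact measurableSet_lt measurable_const (measurable_fst.div measurable_snd)
      · exact measurableSet_lt (measurable_fst.div measurable_snd) measurable_const
    have hcongr : ∀ y ∈ Yt t,
        (y.1 ^ 3 * y.2 ^ 3)⁻¹ * ind (Ltilde y.1 y.2 θ₁ θ₂ ∩ calTs s = ∅) =
          (y.1 ^ 3 * y.2 ^ 3)⁻¹ * ind (BoxFree (A / y.1) (B / y.2)) := by
      intro y hy
      rw [Ltilde_inter_calTs_eq_empty_iff hy.1 hy.2.1 hsin h]
    rw [setIntegral_congr_fun hYt hcongr, setIntegral_Yt_boxFree hA0 hB0, ← mul_pow, hAB]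
    · rw [mul_pow, mul_pow, Real.sq_sqrt (by positivity), div_pow, Real.sq_sqrt (by norm_num)]
      field_simp
      norm_num
    · rw [hAB]
      have h₁ := one_le_triangleWidth hsin
      have h₂ : lam / 2 ≤ octagonSupport θ₂ / √2 := by
        rw [le_div_iff₀ h2]
        linarith [half_lam_add_one_le_octagonSupport θ₂, lam_mul_sqrt_two]
      calc t * lam = (2 * t) * 1 * (lam / 2) := by ring
        _ ≤ _ := by gcongr
  · have hz : ∀ y : ℝ × ℝ,
        (y.1 ^ 3 * y.2 ^ 3)⁻¹ * ind (Ltilde y.1 y.2 θ₁ θ₂ ∩ calTs s = ∅) = 0 := by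
      intro y
      have := (Ltilde_inter_calTs_nonempty y.1 y.2 θ₂ hs0 (not_le.1 h)).ne_empty
      simp [ind, this]
    simp only [hz, integral_zero, mul_zero, zero_mul]

theorem stmt7 :
    CP = (Real.sqrt 2 - 1) / (Real.sqrt 2 * zetaK2 ^ 2) ∧
    ∀ t > (0:ℝ), ∃ s₀ > (0:ℝ), ∀ s ≥ s₀, GM t s = CP / s := by
  have h2 : 0 < √2 := by positivity
  have hsq := Real.sq_sqrt (show (0 : ℝ) ≤ 2 by norm_num)
  have hpi := Real.pi_pos
  refine ⟨?_, fun t ht => ⟨4 * t ^ 2 * thetaHat, ?_, fun s hs => ?_⟩⟩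
  · unfold CP zetaK2
    field_simp
    linear_combination (-2304 : ℝ) * hsq
  · have := thetaHat_pos
    positivity
  · have hs0 : 0 < s := lt_of_lt_of_le (by have := thetaHat_pos; positivity) hs
    have hl := lam_pos
    have inner : ∀ θ₂, ∫ θ₁ in Ico (0 : ℝ) Real.pi, ∫ y in Yt t, ∫ _x in Fdom,
        (y.1 ^ 3 * y.2 ^ 3)⁻¹ * ind (Ltilde y.1 y.2 θ₁ θ₂ ∩ calTs s = ∅) =
        (4 * √2 * lam * thetaHat / s) * (octagonSupport θ₂ ^ 2)⁻¹ := by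
      intro θ₂
      rw [setIntegral_congr_fun measurableSet_Ico fun θ₁ h => setIntegral_Yt_Fdom ht hs h,
        integral_const_mul, integral_mul_const, integral_triangleWidth, one_mul]
    rw [GM]
    simp only [inner]
    rw [integral_const_mul, integral_octagonSupport, cH, thetaHat, CP, ← lam_mul_sqrt_two]
    have hinv : lam⁻¹ = √2 - 1 := inv_lam
    have e : 4 * √2 * lam * (48 * √2 / Real.pi ^ 4) / s * (4 / (lam * (lam * √2))) =
        768 * √2 * lam⁻¹ / Real.pi ^ 4 / s := by
      field_simp; norm_num
    rw [e, hinv]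
    field_simp
    linear_combination (2304 : ℝ) * hsq

end
end
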